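/- arXiv:1811.04429 — 8 statements merged into one kernel-verified Lean document; each statement's English description precedes it below -/
import Mathlib

section
/- Let G be a finite simple chordal graph and let B be an induced complete bipartite subgraph of G with parts B_X = {x} and B_Y = {y_1,...,y_k}. Let C be a connected component of the subgraph of G induced by M_2(B). Then f(V(C)) = N_1(V(C)) ∩ M_1(B) is a clique in G. -/
open SimpleGraph

/-- `N₁(S)`: the set of vertices at distance exactly 1 from the vertex set `S`. -/
def nOne {V : Type*} (G : SimpleGraph V) (S : Set V) : Set V :=
  {v | v ∉ S ∧ ∃ s ∈ S, G.Adj v s}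

/-- `N₂(S)`: the set of vertices at distance exactly 2 from the vertex set `S`. -/
def nTwo {V : Type*} (G : SimpleGraph V) (S : Set V) : Set V :=
  {v | v ∉ S ∧ (∀ s ∈ S, ¬ G.Adj v s) ∧ ∃ u, G.Adj v u ∧ ∃ s ∈ S, G.Adj u s}

/-- A graph is chordal if every induced cycle is a triangle, i.e. it has no
induced cycle of length at least 4. -/
def IsChordal {V : Type*} (G : SimpleGraph V) : Prop :=
  ∀ n : ℕ, 4 ≤ n → ∀ s : Set V, IsEmpty (G.induce s ≃g cycleGraph n)

/-- A set of vertices is independent if its elements are pairwise nonadjacent. -/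
def IsIndepSet {V : Type*} (G : SimpleGraph V) (S : Set V) : Prop :=
  S.Pairwise fun a b => ¬ G.Adj a b

/-- `B` is an induced complete bipartite subgraph of `G` with parts `B_X = {x}` and
`B_Y = Y`: `Y` is a nonempty independent set not containing `x`, and `x` is adjacent
to every vertex of `Y`. -/
def IsInducedStar {V : Type*} (G : SimpleGraph V) (x : V) (Y : Set V) : Prop :=
  Y.Nonempty ∧ x ∉ Y ∧ (∀ y ∈ Y, G.Adj x y) ∧ ∀ y₁ ∈ Y, ∀ y₂ ∈ Y, ¬ G.Adj y₁ y₂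

/-- `M₁(B_X) = N₁(B_X) ∩ N₂(B_Y)` where `B_X = {x}` and `B_Y = Y`. -/
def M1X {V : Type*} (G : SimpleGraph V) (x : V) (Y : Set V) : Set V :=
  nOne G {x} ∩ nTwo G Y

/-- `M₁(B_Y) = N₁(B_Y) ∩ N₂(B_X)`. -/
def M1Y {V : Type*} (G : SimpleGraph V) (x : V) (Y : Set V) : Set V :=
  nOne G Y ∩ nTwo G {x}

/-- `M₂(B_X) = N₁(M₁(B_X)) ∩ N₂(B_X)`. -/
def M2X {V : Type*} (G : SimpleGraph V) (x : V) (Y : Set V) : Set V :=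
  nOne G (M1X G x Y) ∩ nTwo G {x}

/-- `M₂(B_Y) = N₁(M₁(B_Y)) ∩ N₂(B_Y)`. -/
def M2Y {V : Type*} (G : SimpleGraph V) (x : V) (Y : Set V) : Set V :=
  nOne G (M1Y G x Y) ∩ nTwo G Y

/-- `M₁(B) = M₁(B_X) ∪ M₁(B_Y)`. -/
def M1B {V : Type*} (G : SimpleGraph V) (x : V) (Y : Set V) : Set V :=
  M1X G x Y ∪ M1Y G x Y

/-- `M₂(B) = M₂(B_X) ∪ M₂(B_Y)`. -/
def M2B {V : Type*} (G : SimpleGraph V) (x : V) (Y : Set V) : Set V :=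
  M2X G x Y ∪ M2Y G x Y

/-- `f(S) = N₁(S) ∩ M₁(B)`. -/
def fSet {V : Type*} (G : SimpleGraph V) (x : V) (Y : Set V) (S : Set V) : Set V :=
  nOne G S ∩ M1B G x Y

/-- The subgraph of `G` with edges restricted to the vertex set `W`
(the induced subgraph on `W`, viewed on the same vertex type). -/
def restrict {V : Type*} (G : SimpleGraph V) (W : Set V) : SimpleGraph V where
  Adj a b := G.Adj a b ∧ a ∈ W ∧ b ∈ W
  symm := ⟨fun _ _ ⟨h, ha, hb⟩ => ⟨h.symm, hb, ha⟩⟩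
  loopless := ⟨fun a ⟨h, _, _⟩ => G.loopless.irrefl a h⟩

/-- `C` is (the vertex set of) a connected component of the subgraph of `G`
induced by `W`. -/
def IsCompOf {V : Type*} (G : SimpleGraph V) (W C : Set V) : Prop :=
  C ⊆ W ∧ ∃ v ∈ C, C = {u | u ∈ W ∧ (restrict G W).Reachable u v}

theorem restrict_mono {V : Type*} (G : SimpleGraph V) {W W' : Set V} (h : W ⊆ W') :
    restrict G W ≤ restrict G W' :=
  fun _ _ hab => ⟨hab.1, h hab.2.1, h hab.2.2⟩

/-- `P` restricts to an induced path `P 0, …, P n` of `G` whose interior lies in `S`. -/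
structure IsInducedPath {V : Type*} (G : SimpleGraph V) (S : Set V) (n : ℕ) (P : ℕ → V) :
    Prop where
  mem : ∀ i, 0 < i → i < n → P i ∈ S
  ne : ∀ i j, i < j → j ≤ n → P i ≠ P j
  adj_iff : ∀ i j, i < j → j ≤ n → (G.Adj (P i) (P j) ↔ j = i + 1)

/-- Two distinct nonadjacent vertices with neighbours in the same component of `S` are
joined by an induced path of length at least 2 with interior in `S`. -/
theorem exists_isInducedPath {V : Type*} (G : SimpleGraph V) {S : Set V} {a b s t : V}
    (hne : a ≠ b) (hab : ¬ G.Adj a b) (hs : s ∈ S) (ht : t ∈ S)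
    (has : G.Adj a s) (htb : G.Adj t b) (hst : (restrict G S).Reachable s t) :
    ∃ n P, 2 ≤ n ∧ P 0 = a ∧ P n = b ∧ IsInducedPath G S n P := by
  set W := insert a (insert b S)
  have hSW : S ⊆ W := fun v hv => Or.inr (Or.inr hv)
  have haW : a ∈ W := Or.inl rfl
  have hbW : b ∈ W := Or.inr (Or.inl rfl)
  have h1 : (restrict G W).Adj a s := ⟨has, haW, hSW hs⟩
  have h2 : (restrict G W).Adj t b := ⟨htb, hSW ht, hbW⟩
  have hr : (restrict G W).Reachable a b :=
    (h1.reachable.trans (hst.mono (restrict_mono G hSW))).trans h2.reachable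
  obtain ⟨w, hw⟩ := hr.exists_walk_length_eq_dist
  have hadj : ∀ i < w.length, (restrict G W).Adj (w.getVert i) (w.getVert (i + 1)) :=
    fun i hi => w.adj_getVert_succ hi
  have hn0 : w.length ≠ 0 := fun h => hne (Walk.eq_of_length_eq_zero h)
  have hdist : ∀ i ≤ w.length, (restrict G W).dist a (w.getVert i) = i := by
    intro i hi
    have h3 := dist_le (w.take i)
    have h4 := dist_le (w.drop i)
    have h6 := (w.take i).reachable.dist_triangle_left b
    rw [Walk.take_length] at h3
    rw [Walk.drop_length] at h4
    omega
  have hmemW : ∀ i ≤ w.length, w.getVert i ∈ W := by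
    intro i hi
    rcases Nat.lt_or_ge i w.length with h | h
    · exact (hadj i h).2.1
    · rw [w.getVert_of_length_le h]; exact hbW
  have hinj : ∀ i j, i < j → j ≤ w.length → w.getVert i ≠ w.getVert j := by
    intro i j hij hj h
    have h3 := hdist i (by omega)
    have h4 := hdist j hj
    rw [h] at h3
    omega
  refine ⟨w.length, w.getVert, ?_, w.getVert_zero, w.getVert_length, ?_, hinj, ?_⟩
  · by_contra hlt
    have h3 : w.length = 1 := by omega
    exact hab (Walk.adj_of_length_eq_one h3).1
  · intro i hi hin
    rcases hmemW i hin.le with h | h | h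
    · exact absurd (w.getVert_zero.trans h.symm) (hinj 0 i hi hin.le)
    · exact absurd (h.trans w.getVert_length.symm) (hinj i _ hin le_rfl)
    · exact h
  · intro i j hij hj
    constructor
    · intro h
      have h3 : (restrict G W).Adj (w.getVert i) (w.getVert j) :=
        ⟨h, hmemW i (by omega), hmemW j hj⟩
      have h4 := dist_le ((w.take i).concat h3)
      rw [Walk.length_concat, Walk.take_length, hdist j hj] at h4
      omega
    · rintro rfl
      exact (hadj i (by omega)).1

/-- A chordal graph has no induced cycle `c 0, …, c (n - 1)` with `4 ≤ n`. -/
theorem IsChordal.false_of_cycle {V : Type*} {G : SimpleGraph V} (hG : IsChordal G) {n : ℕ}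
    (hn : 4 ≤ n) (c : ℕ → V) (hne : ∀ i j, i < j → j < n → c i ≠ c j)
    (hadj : ∀ i j, i < j → j < n →
      (G.Adj (c i) (c j) ↔ j = i + 1 ∨ (i = 0 ∧ j + 1 = n))) : False := by
  have hinj : Function.Injective fun i : Fin n => c i := by
    intro i j h
    rcases lt_trichotomy i j with h' | h' | h'
    · exact absurd h (hne i j h' j.2)
    · exact h'
    · exact absurd h.symm (hne j i h' i.2)
  have key : ∀ i j : Fin n, i < j → (G.Adj (c i) (c j) ↔ (cycleGraph n).Adj i j) := by
    intro i j hij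
    rw [hadj i j hij j.2, cycleGraph_adj', Fin.coe_sub_iff_le.2 hij.le, Fin.coe_sub_iff_lt.2 hij]
    have := i.2
    have := j.2
    have : (i : ℕ) < j := hij
    omega
  refine (hG n hn (Set.range fun i : Fin n => c i)).false
    (RelIso.symm ⟨Equiv.ofInjective _ hinj, ?_⟩)
  intro i j
  change G.Adj (c i) (c j) ↔ _
  rcases lt_trichotomy i j with h | rfl | h
  · exact key i j h
  · simp
  · rw [G.adj_comm, key j i h, SimpleGraph.adj_comm]

/-- In a chordal graph, two distinct vertices joined by paths through two disjoint
sets with no edges between them are adjacent. -/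
theorem IsChordal.adj_of_anticomplete {V : Type*} {G : SimpleGraph V} (hG : IsChordal G)
    {S T : Set V} (hdisj : ∀ u ∈ S, ∀ v ∈ T, u ≠ v) (hanti : ∀ u ∈ S, ∀ v ∈ T, ¬ G.Adj u v)
    {a b s s' t t' : V} (hne : a ≠ b)
    (hs : s ∈ S) (hs' : s' ∈ S) (has : G.Adj a s) (hsb : G.Adj s' b)
    (hss : (restrict G S).Reachable s s')
    (ht : t ∈ T) (ht' : t' ∈ T) (hat : G.Adj a t) (htb : G.Adj t' b)
    (htt : (restrict G T).Reachable t t') : G.Adj a b := by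
  by_contra hab
  obtain ⟨p, P, hp, hP0, hPp, hP⟩ := exists_isInducedPath G hne hab hs hs' has hsb hss
  obtain ⟨q, Q, hq, hQ0, hQq, hQ⟩ := exists_isInducedPath G hne hab ht ht' hat htb htt
  refine hG.false_of_cycle (n := p + q) (by omega)
    (fun k => if k ≤ p then P k else Q (p + q - k)) ?_ ?_
  · intro i j hij hj
    by_cases hjp : j ≤ p
    · simpa only [if_pos hjp, if_pos (hij.le.trans hjp)] using hP.ne i j hij hjp
    by_cases hip : i ≤ p
    · simp only [if_pos hip, if_neg hjp]
      rcases Nat.eq_zero_or_pos i with rfl | hi0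
      · rw [hP0, ← hQ0]
        exact hQ.ne _ _ (by omega) (by omega)
      rcases hip.eq_or_lt with rfl | hip
      · rw [hPp, ← hQq]
        exact (hQ.ne _ _ (by omega) (by omega)).symm
      · exact hdisj _ (hP.mem i hi0 hip) _ (hQ.mem _ (by omega) (by omega))
    · simp only [if_neg hip, if_neg hjp]
      exact (hQ.ne _ _ (by omega) (by omega)).symm
  · intro i j hij hj
    by_cases hjp : j ≤ p
    · simp only [if_pos hjp, if_pos (hij.le.trans hjp)]
      rw [hP.adj_iff i j hij hjp]
      omega
    by_cases hip : i ≤ p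
    · simp only [if_pos hip, if_neg hjp]
      rcases Nat.eq_zero_or_pos i with rfl | hi0
      · rw [hP0, ← hQ0, hQ.adj_iff _ _ (by omega) (by omega)]
        omega
      rcases hip.eq_or_lt with rfl | hip
      · rw [hPp, ← hQq, G.adj_comm, hQ.adj_iff _ _ (by omega) (by omega)]
        omega
      · have := hanti _ (hP.mem i hi0 hip) (Q (p + q - j)) (hQ.mem _ (by omega) (by omega))
        simp only [this, false_iff]
        omega
    · simp only [if_neg hip, if_neg hjp]
      rw [G.adj_comm, hQ.adj_iff _ _ (by omega) (by omega)]
      omega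

/-- A chordal graph has no induced 4-cycle. -/
theorem IsChordal.false_of_four_cycle {V : Type*} {G : SimpleGraph V} (hG : IsChordal G)
    {a b c d : V} (hab : G.Adj a b) (hbc : G.Adj b c) (hcd : G.Adj c d) (hda : G.Adj d a)
    (hac : ¬ G.Adj a c) (hbd : ¬ G.Adj b d) (hne : a ≠ c) (hne' : b ≠ d) : False := by
  refine hac (hG.adj_of_anticomplete (S := {b}) (T := {d}) ?_ ?_ hne rfl rfl hab hbc
    (Reachable.refl _) rfl rfl hda.symm hcd.symm (Reachable.refl _))
  · rintro _ rfl _ rfl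
    exact hne'
  · rintro _ rfl _ rfl
    exact hbd

theorem ne_and_not_adj_of_mem_M2B {V : Type*} {G : SimpleGraph V} (hG : IsChordal G)
    {x : V} {Y : Set V} (hB : IsInducedStar G x Y) {u v : V} (hu : u ∈ M2B G x Y)
    (hv : v ∈ insert x Y) : u ≠ v ∧ ¬ G.Adj u v := by
  obtain ⟨⟨y₀, hy₀⟩, hxY, hadj, -⟩ := hB
  rcases hu with ⟨⟨-, m, ⟨⟨-, x', hx', hmx⟩, hmY', hmY, -⟩, hum⟩, hux, hnux, -⟩ |
    ⟨⟨-, m, ⟨⟨-, y, hy, hmy⟩, hmx, hnmx, -⟩, hum⟩, huY, hnuY, -⟩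
  · obtain rfl : x' = x := hx'
    have hnux := hnux x' rfl
    rcases hv with rfl | hv
    · exact ⟨hux, hnux⟩
    · refine ⟨?_, fun huv => ?_⟩
      · rintro rfl
        exact hnux (hadj u hv).symm
      · refine hG.false_of_four_cycle hum hmx (hadj v hv) huv.symm hnux (hmY v hv) hux ?_
        rintro rfl
        exact hmY' hv
  · have hnmx := hnmx x rfl
    rcases hv with rfl | hv
    · refine ⟨?_, fun huv => ?_⟩
      · rintro rfl
        exact hnuY y₀ hy₀ (hadj y₀ hy₀)
      · refine hG.false_of_four_cycle hum hmy (hadj y hy).symm huv.symm (hnuY y hy) hnmx ?_ hmx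
        rintro rfl
        exact huY hy
    · refine ⟨?_, hnuY v hv⟩
      rintro rfl
      exact huY hv

theorem reachable_center_of_mem {V : Type*} {G : SimpleGraph V} {x : V} {Y : Set V}
    (hB : IsInducedStar G x Y) {v : V} (hv : v ∈ insert x Y) :
    (restrict G (insert x Y)).Reachable x v := by
  rcases hv with rfl | hv
  · exact Reachable.refl _
  · have h : (restrict G (insert x Y)).Adj x v := ⟨hB.2.2.1 v hv, Or.inl rfl, Or.inr hv⟩
    exact h.reachable

theorem exists_adj_of_mem_M1B {V : Type*} {G : SimpleGraph V} {x : V} {Y : Set V} {a : V}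
    (ha : a ∈ M1B G x Y) : ∃ t ∈ insert x Y, G.Adj a t := by
  rcases ha with ⟨⟨-, t, ht, hat⟩, -⟩ | ⟨⟨-, t, ht, hat⟩, -⟩
  · exact ⟨t, Or.inl ht, hat⟩
  · exact ⟨t, Or.inr ht, hat⟩

/-- For every connected component `C` of the subgraph of `G` induced by `M₂(B)`,
the set `f(V(C)) = N₁(V(C)) ∩ M₁(B)` is a clique of `G`. -/
theorem stmt7 {V : Type*} (G : SimpleGraph V) (hG : IsChordal G)
    (x : V) (Y : Set V) (hB : IsInducedStar G x Y)
    (C : Set V) (hC : IsCompOf G (M2B G x Y) C) :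
    G.IsClique (fSet G x Y C) := by
  obtain ⟨hCW, v, -, hCv⟩ := hC
  have hreach : ∀ u ∈ C, (restrict G (M2B G x Y)).Reachable u v := by
    intro u hu
    rw [hCv] at hu
    exact hu.2
  rintro a ⟨⟨-, s, hs, has⟩, haM⟩ b ⟨⟨-, s', hs', hbs⟩, hbM⟩ hne
  obtain ⟨t, ht, hat⟩ := exists_adj_of_mem_M1B haM
  obtain ⟨t', ht', hbt⟩ := exists_adj_of_mem_M1B hbM
  exact hG.adj_of_anticomplete
    (fun _ hu _ hw => (ne_and_not_adj_of_mem_M2B hG hB hu hw).1)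
    (fun _ hu _ hw => (ne_and_not_adj_of_mem_M2B hG hB hu hw).2)
    hne (hCW hs) (hCW hs') has hbs.symm ((hreach s hs).trans (hreach s' hs').symm)
    ht ht' hat hbt.symm
    ((reachable_center_of_mem hB ht).symm.trans (reachable_center_of_mem hB ht'))
end

section
/- Let G be a finite simple chordal graph and let B be an induced complete bipartite subgraph of G with parts B_X = {x} and B_Y = {y_1,...,y_k}. Let C be a connected component of the subgraph of G induced by M_2(B), let w_1, w_2 ∈ V(C), and let P = (w_1 = u_1, ..., u_r = w_2) be a shortest path in C between w_1 and w_2. (i) If v ∈ f(w_1) \ f(w_2), then there exists an index 1 ≤ s < r such that v ∈ f(u_i) if and only if i ≤ s. (ii) If v ∈ f(w_2) \ f(w_1), then there exists an index 1 < t ≤ r such that v ∈ f(u_i) if and only if i ≥ t. -/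
open SimpleGraph

theorem cycleGraph_adj_iff_val {n : ℕ} {i j : Fin n} :
    (cycleGraph n).Adj i j ↔
      i.val = j.val + 1 ∨ j.val = i.val + 1 ∨
        (n ≠ 1 ∧ i.val = 0 ∧ j.val + 1 = n) ∨ (n ≠ 1 ∧ j.val = 0 ∧ i.val + 1 = n) := by
  rw [cycleGraph_adj']
  have hi := i.isLt
  have hj := j.isLt
  rcases lt_trichotomy i j with h | rfl | h
  · rw [Fin.coe_sub_iff_lt.mpr h, Fin.coe_sub_iff_le.mpr h.le]
    have := Fin.lt_def.mp h
    omega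
  · have : (i - i).val = 0 := by
      rw [Fin.coe_sub_iff_le.mpr le_rfl, Nat.sub_self]
    omega
  · rw [Fin.coe_sub_iff_lt.mpr h, Fin.coe_sub_iff_le.mpr h.le]
    have := Fin.lt_def.mp h
    omega

/-- In a chordal graph, no vertex `v` is adjacent to exactly the two ends of an induced path
`p 0, ..., p m` with `2 ≤ m`. -/
theorem IsChordal.false_of_induced_path {V : Type*} {G : SimpleGraph V} (hG : IsChordal G)
    {m : ℕ} (hm : 2 ≤ m) (p : ℕ → V) (v : V)
    (hinj : ∀ i j, i < j → j ≤ m → p i ≠ p j)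
    (hpath : ∀ i j, i < j → j ≤ m → (G.Adj (p i) (p j) ↔ j = i + 1))
    (hne : ∀ i ≤ m, v ≠ p i)
    (hv : ∀ i ≤ m, (G.Adj v (p i) ↔ i = 0 ∨ i = m)) : False := by
  have hinj' : Function.Injective
      fun i : Fin (m + 2) => if i.val ≤ m then p i.val else v := by
    intro i j hij
    have hi := i.isLt
    have hj := j.isLt
    ext
    by_contra hne'
    rcases Nat.lt_or_gt_of_ne hne' with h | h <;> grind
  let c : cycleGraph (m + 2) ↪g G :=
    { toFun := fun i => if i.val ≤ m then p i.val else v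
      inj' := hinj'
      map_rel_iff' := by
        intro i j
        have hi := i.isLt
        have hj := j.isLt
        simp only [Function.Embedding.coeFn_mk, cycleGraph_adj_iff_val]
        by_cases h₁ : i.val ≤ m <;> by_cases h₂ : j.val ≤ m
        · rw [if_pos h₁, if_pos h₂]
          rcases lt_trichotomy i.val j.val with h | h | h
          · rw [hpath _ _ h h₂]
            omega
          · rw [h]
            simp only [SimpleGraph.irrefl, false_iff]
            omega
          · rw [G.adj_comm, hpath _ _ h h₁]
            omega
        · rw [if_pos h₁, if_neg h₂, G.adj_comm, hv _ h₁]
          omega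
        · rw [if_neg h₁, if_pos h₂, hv _ h₂]
          omega
        · rw [if_neg h₁, if_neg h₂]
          simp only [SimpleGraph.irrefl, false_iff]
          omega }
  exact (hG (m + 2) (by omega) (Set.range c)).false c.isoInduceRange.symm

theorem IsChordal.adj_of_adj_square {V : Type*} {G : SimpleGraph V} (hG : IsChordal G)
    {v a b c : V} (hva : G.Adj v a) (hab : G.Adj a b) (hbc : G.Adj b c) (hcv : G.Adj c v)
    (hvb : v ≠ b) (hac : a ≠ c) (hnvb : ¬ G.Adj v b) : G.Adj a c := by
  by_contra hnac
  refine hG.false_of_induced_path le_rfl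
    (fun i => if i = 0 then a else if i = 1 then b else c) v ?_ ?_ ?_ ?_
  · intro i j hij hj
    have := hab.ne
    have := hbc.ne
    interval_cases j <;> interval_cases i <;> simp_all
  · intro i j hij hj
    interval_cases j <;> interval_cases i <;> simp_all
  · intro i hi
    have := hva.ne
    have := hcv.ne'
    interval_cases i <;> simp_all
  · intro i hi
    have := hcv.symm
    interval_cases i <;> simp_all

theorem disjoint_M1B_M2B {V : Type*} {G : SimpleGraph V} (hG : IsChordal G)
    {x : V} {Y : Set V} (hB : IsInducedStar G x Y) : Disjoint (M1B G x Y) (M2B G x Y) := by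
  obtain ⟨-, -, hxY, -⟩ := hB
  rw [Set.disjoint_left]
  rintro v (⟨⟨-, x', rfl, hvx⟩, hvY, hnY, -⟩ | ⟨⟨hvY, y, hy, hvy⟩, hvx, hnx, -⟩)
    (⟨⟨-, z, hz, hvz⟩, h₂⟩ | ⟨⟨-, z, hz, hvz⟩, h₂⟩)
  · exact h₂.2.1 _ rfl hvx
  · obtain ⟨⟨-, y, hy, hzy⟩, hzx, hnzx, -⟩ := hz
    exact hnzx _ rfl (hG.adj_of_adj_square hvx (hxY y hy) hzy.symm hvz.symm
      (fun h => hvY (h ▸ hy)) (fun h => hzx h.symm) (hnY y hy)).symm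
  · obtain ⟨⟨-, x', rfl, hzx⟩, hzY, hnzY, -⟩ := hz
    exact hnzY y hy (hG.adj_of_adj_square hvy (hxY y hy).symm hzx.symm hvz.symm
      hvx (fun h => hzY (h ▸ hy)) (hnx _ rfl)).symm
  · exact h₂.2.1 y hy hvy

theorem adj_getVert_iff_of_shortest {V : Type*} {H : SimpleGraph V} {a b : V}
    (P : H.Walk a b) (hshort : ∀ Q : H.Walk a b, P.length ≤ Q.length) {i j : ℕ}
    (hij : i < j) (hj : j ≤ P.length) :
    H.Adj (P.getVert i) (P.getVert j) ↔ j = i + 1 := by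
  refine ⟨fun h => ?_, ?_⟩
  · have := hshort ((P.take i).append (Walk.cons h (P.drop j)))
    simp only [Walk.length_append, Walk.length_cons, Walk.take_length, Walk.drop_length] at this
    omega
  · rintro rfl
    exact P.adj_getVert_succ (by omega)

theorem getVert_mem_of_restrict {V : Type*} {G : SimpleGraph V} {C : Set V} {a b : V}
    (hb : b ∈ C) (P : (restrict G C).Walk a b) (i : ℕ) : P.getVert i ∈ C := by
  rcases lt_or_ge i P.length with h | h
  · exact (P.adj_getVert_succ h).2.1
  · rwa [P.getVert_of_length_le h]

/-- In a chordal graph, the neighbours of a vertex off an induced path occur consecutively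
on that path. -/
theorem IsChordal.adj_of_adj_of_adj {V : Type*} {G : SimpleGraph V} (hG : IsChordal G)
    {L : ℕ} (p : ℕ → V) (v : V)
    (hinj : ∀ i j, i < j → j ≤ L → p i ≠ p j)
    (hpath : ∀ i j, i < j → j ≤ L → (G.Adj (p i) (p j) ↔ j = i + 1))
    (hne : ∀ i ≤ L, v ≠ p i) {i j k : ℕ} (hik : i ≤ k) (hkj : k ≤ j) (hj : j ≤ L)
    (hvi : G.Adj v (p i)) (hvj : G.Adj v (p j)) : G.Adj v (p k) := by
  induction hd : j - i using Nat.strong_induction_on generalizing i j with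
  | _ d ih =>
    by_cases hl : ∃ l, i < l ∧ l < j ∧ G.Adj v (p l)
    · obtain ⟨l, hil, hlj, hvl⟩ := hl
      rcases le_total k l with h | h
      · exact ih (l - i) (by omega) hik h (by omega) hvi hvl rfl
      · exact ih (j - l) (by omega) h hkj hj hvl hvj rfl
    · push Not at hl
      rcases hik.eq_or_lt with rfl | hik
      · exact hvi
      rcases hkj.eq_or_lt with rfl | hkj
      · exact hvj
      refine (hG.false_of_induced_path (m := j - i) (by omega) (fun n => p (i + n)) v
        ?_ ?_ ?_ ?_).elim
      · exact fun a b hab hb => hinj _ _ (by omega) (by omega)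
      · intro a b hab hb
        rw [hpath _ _ (by omega) (by omega)]
        omega
      · exact fun a ha => hne _ (by omega)
      · intro a ha
        constructor
        · intro h
          by_contra! hcon
          exact hl (i + a) (by omega) (by omega) h
        · rintro (rfl | rfl)
          · exact hvi
          · rwa [Nat.add_sub_cancel' (by omega)]

/-- Monotonicity of `f` along a shortest path in a connected component `C` of the
subgraph induced by `M₂(B)`. The path `P = (w₁ = u₁, ..., uᵣ = w₂)` is recorded as a
walk in the induced subgraph on `C`; its vertices `u₁, ..., uᵣ` are
`P.support.getD 0 w₁, ..., P.support.getD P.length w₁` (0-indexed).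
(i) If `v ∈ f(w₁) \ f(w₂)` then there is an index `s` with `1 ≤ s < r`
(0-indexed: `s < P.length`) such that `v ∈ f(uᵢ) ↔ i ≤ s`.
(ii) If `v ∈ f(w₂) \ f(w₁)` then there is an index `t` with `1 < t ≤ r`
(0-indexed: `1 ≤ t ≤ P.length`) such that `v ∈ f(uᵢ) ↔ i ≥ t`. -/
theorem stmt8 {V : Type*} (G : SimpleGraph V) (hG : IsChordal G)
    (x : V) (Y : Set V) (hB : IsInducedStar G x Y)
    (C : Set V) (hC : IsCompOf G (M2B G x Y) C)
    (w₁ w₂ : V) (hw₁ : w₁ ∈ C) (hw₂ : w₂ ∈ C)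
    (P : (restrict G C).Walk w₁ w₂) (hP : P.IsPath)
    (hshort : ∀ Q : (restrict G C).Walk w₁ w₂, P.length ≤ Q.length)
    (v : V) :
    (v ∈ fSet G x Y {w₁} \ fSet G x Y {w₂} →
      ∃ s, s < P.length ∧
        ∀ i ≤ P.length, (v ∈ fSet G x Y {P.support.getD i w₁} ↔ i ≤ s)) ∧
    (v ∈ fSet G x Y {w₂} \ fSet G x Y {w₁} →
      ∃ t, 1 ≤ t ∧ t ≤ P.length ∧
        ∀ i ≤ P.length, (v ∈ fSet G x Y {P.support.getD i w₁} ↔ t ≤ i)) := by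
  have hmem := getVert_mem_of_restrict hw₂ P
  have hinj : ∀ i j, i < j → j ≤ P.length → P.getVert i ≠ P.getVert j :=
    fun i j hij hj h => hij.ne (hP.getVert_injOn (hij.le.trans hj) hj h)
  have hpath : ∀ i j, i < j → j ≤ P.length →
      (G.Adj (P.getVert i) (P.getVert j) ↔ j = i + 1) := fun i j hij hj => by
    rw [← adj_getVert_iff_of_shortest P hshort hij hj]
    exact ⟨fun h => ⟨h, hmem i, hmem j⟩, fun h => h.1⟩
  have hoff : v ∈ M1B G x Y → ∀ i, v ≠ P.getVert i := fun hv i h =>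
    Set.disjoint_left.mp (disjoint_M1B_M2B hG hB) hv (h ▸ hC.1 (hmem i))
  have hf : ∀ w, v ∈ fSet G x Y {w} ↔ G.Adj v w ∧ v ∈ M1B G x Y := fun w => by
    refine ⟨fun ⟨⟨_, w', hw', h⟩, hv⟩ => ⟨hw' ▸ h, hv⟩, fun ⟨h, hv⟩ => ⟨⟨h.ne, w, rfl, h⟩, hv⟩⟩
  have hget : ∀ i ≤ P.length, P.support.getD i w₁ = P.getVert i := fun i hi => by
    have h : i < P.support.length := by rw [Walk.length_support]; omega
    rw [List.getD_eq_getElem _ _ h, Walk.support_getElem_eq_getVert]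
  simp only [Set.mem_sdiff, hf]
  classical
  constructor
  · rintro ⟨⟨h₁, hv⟩, h₂⟩
    have hlast : ¬ G.Adj v (P.getVert P.length) := by
      rw [P.getVert_length]
      exact fun h => h₂ ⟨h, hv⟩
    have hex : ∃ n, ¬ G.Adj v (P.getVert n) := ⟨_, hlast⟩
    have hpos : Nat.find hex ≠ 0 := fun h => by
      have := Nat.find_spec hex
      rw [h, P.getVert_zero] at this
      exact this h₁
    have hle := Nat.find_min' hex hlast
    refine ⟨Nat.find hex - 1, by omega, fun i hi => ?_⟩
    rw [hget i hi, and_iff_left hv]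
    constructor
    · intro h
      by_contra hlt
      exact Nat.find_spec hex (hG.adj_of_adj_of_adj P.getVert v hinj hpath
        (fun i _ => hoff hv i) (Nat.zero_le _) (by omega) hi (by rwa [P.getVert_zero]) h)
    · exact fun h => not_not.mp (Nat.find_min hex (by omega))
  · rintro ⟨⟨h₂, hv⟩, h₁⟩
    have hlast : G.Adj v (P.getVert P.length) := by rwa [P.getVert_length]
    have hex : ∃ n, G.Adj v (P.getVert n) := ⟨_, hlast⟩
    have hpos : Nat.find hex ≠ 0 := fun h => by
      have := Nat.find_spec hex
      rw [h, P.getVert_zero] at this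
      exact h₁ ⟨this, hv⟩
    refine ⟨Nat.find hex, by omega, Nat.find_min' hex hlast, fun i hi => ?_⟩
    rw [hget i hi, and_iff_left hv]
    exact ⟨fun h => Nat.find_min' hex h, fun h => hG.adj_of_adj_of_adj P.getVert v hinj hpath
      (fun i _ => hoff hv i) h hi le_rfl (Nat.find_spec hex) hlast⟩
end

section
/- Let G be a finite simple chordal graph and let B be an induced complete bipartite subgraph of G with parts B_X = {x} and B_Y = {y_1,...,y_k}. Then B is a generating subgraph of G if and only if there exists an independent set S ⊆ M_2(B) that dominates M_1(B) (i.e., M_1(B) ⊆ N_1(S)). -/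
open SimpleGraph

/-- A maximal independent set of `G`. -/
def IsMaxIndep {V : Type*} (G : SimpleGraph V) (S : Set V) : Prop :=
  _root_.IsIndepSet G S ∧ ∀ T, _root_.IsIndepSet G T → S ⊆ T → S = T

/-- `B` (an induced complete bipartite subgraph with parts `BX` and `BY`) is
generating: there is an independent set `S` (a witness) such that `S ∪ BX`
and `S ∪ BY` are both maximal independent sets of `G`. -/
def IsGenerating {V : Type*} (G : SimpleGraph V) (BX BY : Set V) : Prop :=
  ∃ S : Set V, _root_.IsIndepSet G S ∧ IsMaxIndep G (S ∪ BX) ∧ IsMaxIndep G (S ∪ BY)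

/-- A chordal graph has no induced cycle of length four. -/
theorem IsChordal.adj_or_adj {V : Type*} {G : SimpleGraph V} (hG : IsChordal G) {a b c d : V}
    (hab : G.Adj a b) (hbc : G.Adj b c) (hcd : G.Adj c d) (hda : G.Adj d a)
    (hac : a ≠ c) (hbd : b ≠ d) : G.Adj a c ∨ G.Adj b d := by
  by_contra! h
  have hf : Function.Injective ![a, b, c, d] := by
    intro i j hij
    have := hab.ne
    have := hbc.ne
    have := hcd.ne
    have := hda.ne
    fin_cases i <;> fin_cases j <;> simp_all
  refine (hG 4 le_rfl (Set.range ![a, b, c, d])).false (RelIso.symm ⟨Equiv.ofInjective _ hf, ?_⟩)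
  intro i j
  have hca : ¬ G.Adj c a := fun e => h.1 e.symm
  have hdb : ¬ G.Adj d b := fun e => h.2 e.symm
  fin_cases i <;> fin_cases j <;>
    simp [cycleGraph_adj, h.1, h.2, hab, hab.symm, hbc, hbc.symm, hcd, hcd.symm, hda, hda.symm,
      hca, hdb] <;> decide

/-- An independent set is maximal iff every vertex outside it has a neighbor in it. -/
theorem isMaxIndep_iff {V : Type*} {G : SimpleGraph V} {S : Set V} :
    IsMaxIndep G S ↔ _root_.IsIndepSet G S ∧ ∀ v ∉ S, ∃ s ∈ S, G.Adj v s := by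
  refine and_congr_right fun hS => ⟨fun h v hv => ?_, fun h T hT hST => ?_⟩
  · by_contra! hn
    have hins : _root_.IsIndepSet G (insert v S) :=
      hS.insert fun s hs _ => ⟨hn s hs, fun e => hn s hs e.symm⟩
    exact hv (h _ hins (Set.subset_insert v S) ▸ Set.mem_insert v S)
  · refine hST.antisymm fun v hv => ?_
    by_contra hvS
    obtain ⟨s, hs, hvs⟩ := h v hvS
    exact hT hv (hST hs) hvs.ne hvs

/-- Every independent subset of `A` extends to an independent subset of `A` that dominates `A`. -/
theorem exists_isIndepSet_dominating {V : Type*} {G : SimpleGraph V} {S A : Set V}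
    (hS : _root_.IsIndepSet G S) (hSA : S ⊆ A) :
    ∃ W, S ⊆ W ∧ W ⊆ A ∧ _root_.IsIndepSet G W ∧ ∀ v ∈ A, v ∉ W → ∃ w ∈ W, G.Adj v w := by
  obtain ⟨W, hSW, hW⟩ := zorn_subset_nonempty {T | T ⊆ A ∧ _root_.IsIndepSet G T}
    (fun c hc hchain _ => ⟨⋃₀ c, ⟨Set.sUnion_subset fun T hT => (hc hT).1,
      (Set.pairwise_sUnion hchain.directedOn).2 fun T hT => (hc hT).2⟩,
      fun _ => Set.subset_sUnion_of_mem⟩) S ⟨hSA, hS⟩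
  refine ⟨W, hSW, hW.prop.1, hW.prop.2, fun v hvA hvW => ?_⟩
  by_contra! hn
  have hins : _root_.IsIndepSet G (insert v W) :=
    Set.Pairwise.insert hW.prop.2 fun s hs _ => ⟨hn s hs, fun e => hn s hs e.symm⟩
  exact hvW (hW.le_of_ge ⟨Set.insert_subset hvA hW.prop.1, hins⟩ (Set.subset_insert v W)
    (Set.mem_insert v W))

/-- In a chordal graph, `M₂(B)` contains no vertex of `B` and no neighbor of a vertex of `B`. -/
theorem M2B_subset_far {V : Type*} {G : SimpleGraph V} (hG : IsChordal G) {x : V} {Y : Set V}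
    (hB : IsInducedStar G x Y) :
    M2B G x Y ⊆ {v | v ≠ x ∧ v ∉ Y ∧ ¬ G.Adj v x ∧ ∀ y ∈ Y, ¬ G.Adj v y} := by
  obtain ⟨⟨y₀, hy₀⟩, -, hxY, -⟩ := hB
  rintro s (⟨⟨-, v, ⟨⟨-, x', rfl, hvx⟩, hvY, hvnY, -⟩, hsv⟩, hsx, hnsx, -⟩ |
    ⟨⟨-, v, ⟨⟨-, y, hy, hvy⟩, hvx, hvnx, -⟩, hsv⟩, hsY, hsnY, -⟩)
  · have hnsx' : ¬ G.Adj s x' := hnsx x' rfl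
    refine ⟨hsx, fun hs => hnsx' (hxY s hs).symm, hnsx', fun y hy hsy => ?_⟩
    rcases hG.adj_or_adj hsv hvx (hxY y hy) hsy.symm hsx (fun h => hvY (h ▸ hy)) with h | h
    · exact hnsx' h
    · exact hvnY y hy h
  · refine ⟨?_, hsY, fun hsx => ?_, hsnY⟩
    · rintro rfl
      exact hsnY y₀ hy₀ (hxY y₀ hy₀)
    · rcases hG.adj_or_adj hsv hvy (hxY y hy).symm hsx.symm (fun h => hsY (h ▸ hy)) hvx with h | h
      · exact hsnY y hy h
      · exact hvnx x rfl h

/-- `B` is generating iff some independent subset of `M₂(B)` dominates `M₁(B)`. -/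
theorem stmt12 {V : Type*} (G : SimpleGraph V) (hG : IsChordal G)
    (x : V) (Y : Set V) (hB : IsInducedStar G x Y) :
    IsGenerating G {x} Y ↔
      ∃ S ⊆ M2B G x Y, _root_.IsIndepSet G S ∧ M1B G x Y ⊆ nOne G S := by
  have hB' := hB
  obtain ⟨⟨y₀, hy₀⟩, hxnY, hxY, hYY⟩ := hB'
  constructor
  · rintro ⟨W, hW, hWx, hWY⟩
    rw [isMaxIndep_iff] at hWx hWY
    have hWnx : ∀ w ∈ W, ¬ G.Adj w x := fun w hw h => hWx.1 (.inl hw) (.inr rfl) h.ne h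
    have hWnY : ∀ w ∈ W, ∀ y ∈ Y, ¬ G.Adj w y :=
      fun w hw y hy h => hWY.1 (.inl hw) (.inr hy) h.ne h
    refine ⟨W ∩ M2B G x Y, Set.inter_subset_right, hW.mono Set.inter_subset_left, ?_⟩
    rintro v (hv | hv)
    · have hv' := hv
      obtain ⟨⟨hvx, x', rfl, hadj⟩, hvY, hvnY, -⟩ := hv'
      have hvW : v ∉ W := fun h => hWnx v h hadj
      refine ⟨fun h => hvW h.1, ?_⟩
      obtain ⟨w, hw | hw, hvw⟩ := hWY.2 v (by rintro (h | h); exacts [hvW h, hvY h])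
      · refine ⟨w, ⟨hw, .inl ⟨⟨fun h => ?_, v, hv, hvw.symm⟩, ?_, ?_, v, hvw.symm, x', rfl, hadj⟩⟩,
          hvw⟩
        · obtain ⟨⟨-, x'', rfl, h⟩, -⟩ := h
          exact hWnx w hw h
        · rintro rfl
          exact hWnY _ hw y₀ hy₀ (hxY y₀ hy₀)
        · rintro _ rfl
          exact hWnx w hw
      · exact (hvnY w hw hvw).elim
    · have hv' := hv
      obtain ⟨⟨hvY, y, hy, hadj⟩, hvx, hvnx, -⟩ := hv'
      have hvW : v ∉ W := fun h => hWnY v h y hy hadj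
      refine ⟨fun h => hvW h.1, ?_⟩
      obtain ⟨w, hw | hw, hvw⟩ := hWx.2 v (by rintro (h | h); exacts [hvW h, hvx h])
      · refine ⟨w, ⟨hw, .inr ⟨⟨fun h => ?_, v, hv, hvw.symm⟩, fun h => ?_, hWnY w hw,
          v, hvw.symm, y, hy, hadj⟩⟩, hvw⟩
        · obtain ⟨⟨-, y', hy', h⟩, -⟩ := h
          exact hWnY w hw y' hy' h
        · exact hWnx w hw (hxY w h).symm
      · exact (hvnx w hw hvw).elim
  · rintro ⟨S, hSM, hS, hdom⟩
    obtain ⟨W, hSW, hWfar, hW, hWdom⟩ :=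
      exists_isIndepSet_dominating hS (hSM.trans (M2B_subset_far hG hB))
    refine ⟨W, hW, isMaxIndep_iff.2 ⟨?_, fun v hv => ?_⟩, isMaxIndep_iff.2 ⟨?_, fun v hv => ?_⟩⟩
    · rintro a (ha | rfl) b (hb | rfl) hab h
      · exact hW ha hb hab h
      · exact (hWfar ha).2.2.1 h
      · exact (hWfar hb).2.2.1 h.symm
      · exact hab rfl
    · have hvW : v ∉ W := fun h => hv (.inl h)
      have hvx : v ≠ x := fun h => hv (.inr h)
      by_cases hadj : G.Adj v x
      · exact ⟨x, .inr rfl, hadj⟩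
      have hvY : v ∉ Y := fun h => hadj (hxY v h).symm
      by_cases hy : ∃ y ∈ Y, G.Adj v y
      · obtain ⟨y, hy, hvy⟩ := hy
        obtain ⟨-, s, hs, hvs⟩ := hdom (show v ∈ M1B G x Y from .inr ⟨⟨hvY, y, hy, hvy⟩, hvx,
          fun _ h => h ▸ hadj, y, hvy, x, rfl, (hxY y hy).symm⟩)
        exact ⟨s, .inl (hSW hs), hvs⟩
      · push Not at hy
        obtain ⟨w, hw, hvw⟩ := hWdom v ⟨hvx, hvY, hadj, hy⟩ hvW
        exact ⟨w, .inl hw, hvw⟩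
    · rintro a (ha | ha) b (hb | hb) hab h
      · exact hW ha hb hab h
      · exact (hWfar ha).2.2.2 b hb h
      · exact (hWfar hb).2.2.2 a ha h.symm
      · exact hYY a ha b hb h
    · have hvW : v ∉ W := fun h => hv (.inl h)
      have hvY : v ∉ Y := fun h => hv (.inr h)
      by_cases hy : ∃ y ∈ Y, G.Adj v y
      · obtain ⟨y, hy, hvy⟩ := hy
        exact ⟨y, .inr hy, hvy⟩
      push Not at hy
      have hvx : v ≠ x := by
        rintro rfl
        exact hy y₀ hy₀ (hxY y₀ hy₀)
      by_cases hadj : G.Adj v x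
      · obtain ⟨-, s, hs, hvs⟩ := hdom (show v ∈ M1B G x Y from .inl ⟨⟨hvx, x, rfl, hadj⟩, hvY,
          hy, x, hadj, y₀, hy₀, hxY y₀ hy₀⟩)
        exact ⟨s, .inl (hSW hs), hvs⟩
      · obtain ⟨w, hw, hvw⟩ := hWdom v ⟨hvx, hvY, hadj, hy⟩ hvW
        exact ⟨w, .inl hw, hvw⟩
end

section
/- Let G be a finite simple chordal graph and let B be an induced complete bipartite subgraph of G with parts B_X = {x} and B_Y = {y_1,...,y_k}. Let S be a set of vertices containing exactly one vertex w_C from each connected component C of the subgraph of G induced by M_2(B), chosen so that f(w_C) = f(V(C)). Then B is a generating subgraph of G if and only if S dominates M_1(B). -/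
open SimpleGraph

theorem IsIndepSet.insert_of_not_adj {V : Type*} {G : SimpleGraph V} {S : Set V} {v : V}
    (hS : _root_.IsIndepSet G S) (hv : ∀ s ∈ S, ¬ G.Adj v s) :
    _root_.IsIndepSet G (insert v S) :=
  Set.Pairwise.insert hS fun s hs _ => ⟨hv s hs, fun h => hv s hs h.symm⟩

/-- An independent subset of `W` extends to an independent subset of `W` dominating `W`. -/
theorem IsIndepSet.exists_dominating {V : Type*} {G : SimpleGraph V} {S W : Set V}
    (hS : _root_.IsIndepSet G S) (hSW : S ⊆ W) :
    ∃ T, S ⊆ T ∧ T ⊆ W ∧ _root_.IsIndepSet G T ∧ ∀ v ∈ W, v ∉ T → ∃ t ∈ T, G.Adj v t := by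
  obtain ⟨T, hST, hT⟩ := zorn_subset_nonempty {T | T ⊆ W ∧ _root_.IsIndepSet G T}
    (fun c hc hchain _ => ⟨⋃₀ c, ⟨Set.sUnion_subset fun s hs => (hc hs).1,
      (Set.pairwise_sUnion hchain.directedOn).2 fun s hs => (hc hs).2⟩,
      fun s hs => Set.subset_sUnion_of_mem hs⟩) S ⟨hSW, hS⟩
  refine ⟨T, hST, hT.prop.1, hT.prop.2, fun v hv hvT => ?_⟩
  by_contra! hn
  exact hvT (hT.le_of_ge ⟨Set.insert_subset hv hT.prop.1, hT.prop.2.insert_of_not_adj hn⟩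
    (Set.subset_insert v T) (Set.mem_insert v T))

section Star

variable {V : Type*} {G : SimpleGraph V} {x : V} {Y : Set V}

theorem mem_M1X_iff (hB : IsInducedStar G x Y) {v : V} :
    v ∈ M1X G x Y ↔ G.Adj v x ∧ v ∉ Y ∧ ∀ y ∈ Y, ¬ G.Adj v y := by
  obtain ⟨⟨y, hy⟩, -, hxY, -⟩ := hB
  constructor
  · rintro ⟨⟨-, s, rfl, h⟩, hv, hn, -⟩
    exact ⟨h, hv, hn⟩
  · rintro ⟨h, hv, hn⟩
    exact ⟨⟨h.ne, x, rfl, h⟩, hv, hn, x, h, y, hy, hxY y hy⟩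

theorem mem_M1Y_iff (hB : IsInducedStar G x Y) {v : V} :
    v ∈ M1Y G x Y ↔ v ≠ x ∧ ¬ G.Adj v x ∧ ∃ y ∈ Y, G.Adj v y := by
  obtain ⟨-, -, hxY, hY⟩ := hB
  constructor
  · rintro ⟨⟨-, hy⟩, hv, hn, -⟩
    exact ⟨hv, hn x rfl, hy⟩
  · rintro ⟨hv, hn, y, hy, h⟩
    exact ⟨⟨fun hvY => hY v hvY y hy h, y, hy, h⟩, hv, fun s hs => hs ▸ hn,
      y, h, x, rfl, (hxY y hy).symm⟩

/-- In a chordal graph no vertex of `M₂(B)` belongs to `B` or has a neighbour in `B`. -/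
theorem not_adj_of_mem_M2B (hG : IsChordal G) (hB : IsInducedStar G x Y) {v : V}
    (hv : v ∈ M2B G x Y) : v ≠ x ∧ v ∉ Y ∧ ¬ G.Adj v x ∧ ∀ y ∈ Y, ¬ G.Adj v y := by
  have hxY := hB.2.2.1
  rcases hv with ⟨⟨-, m, hm, hvm⟩, hvx, hnx, -⟩ | ⟨⟨-, m, hm, hvm⟩, hvY, hnY, -⟩
  · have hnx := hnx x rfl
    obtain ⟨hmx, hmY, hmn⟩ := (mem_M1X_iff hB).1 hm
    refine ⟨hvx, fun h => hnx (hxY v h).symm, hnx, fun y hy hvy => ?_⟩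
    rcases hG.adj_or_adj hvm hmx (hxY y hy) hvy.symm hvx (fun h => hmY (h ▸ hy)) with h | h
    exacts [hnx h, hmn y hy h]
  · obtain ⟨hmx, hmn, y, hy, hmy⟩ := (mem_M1Y_iff hB).1 hm
    have hne : v ≠ x := fun h => hnY y hy (h ▸ hxY y hy)
    refine ⟨hne, hvY, fun hvx => ?_, hnY⟩
    rcases hG.adj_or_adj hvm hmy (hxY y hy).symm hvx.symm (fun h => hvY (h ▸ hy)) hmx with h | h
    exacts [hnY y hy h, hmn h]

theorem notMem_M2B_of_mem_M1B (hG : IsChordal G) (hB : IsInducedStar G x Y) {v : V}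
    (hv : v ∈ M1B G x Y) : v ∉ M2B G x Y := by
  intro h
  obtain ⟨-, -, hx, hY⟩ := not_adj_of_mem_M2B hG hB h
  rcases hv with hv | hv
  · exact hx ((mem_M1X_iff hB).1 hv).1
  · obtain ⟨-, -, y, hy, hvy⟩ := (mem_M1Y_iff hB).1 hv
    exact hY y hy hvy

theorem mem_M2B_of_adj (hB : IsInducedStar G x Y) {t v : V} (htx : t ≠ x) (htY : t ∉ Y)
    (hnx : ¬ G.Adj t x) (hnY : ∀ y ∈ Y, ¬ G.Adj t y) (hv : v ∈ M1B G x Y) (htv : G.Adj t v) :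
    t ∈ M2B G x Y := by
  rcases hv with hv | hv
  · exact .inl ⟨⟨fun h => hnx ((mem_M1X_iff hB).1 h).1, v, hv, htv⟩, htx, fun s hs => hs ▸ hnx,
      v, htv, x, rfl, ((mem_M1X_iff hB).1 hv).1⟩
  · refine .inr ⟨⟨fun h => ?_, v, hv, htv⟩, htY, hnY, v, htv, ((mem_M1Y_iff hB).1 hv).2.2⟩
    obtain ⟨-, -, y, hy, hty⟩ := (mem_M1Y_iff hB).1 h
    exact hnY y hy hty

/-- A star in a chordal graph is generating as soon as some independent subset of `M₂(B)`
dominates `M₁(B)`. -/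
theorem isGenerating_of_dominates (hG : IsChordal G) (hB : IsInducedStar G x Y) {S : Set V}
    (hS : _root_.IsIndepSet G S) (hSM : S ⊆ M2B G x Y) (hdom : M1B G x Y ⊆ S ∪ nOne G S) :
    IsGenerating G {x} Y := by
  obtain ⟨T, hST, hTW, hT, hTdom⟩ := hS.exists_dominating
    (W := {v | v ≠ x ∧ v ∉ Y ∧ ¬ G.Adj v x ∧ ∀ y ∈ Y, ¬ G.Adj v y})
    fun v hv => not_adj_of_mem_M2B hG hB (hSM hv)
  obtain ⟨⟨y₀, hy₀⟩, -, hxY, hY⟩ := id hB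
  have key : ∀ v ∈ M1B G x Y, ∃ t ∈ T, G.Adj v t := by
    intro v hv
    rcases hdom hv with h | ⟨-, s, hs, hvs⟩
    · exact absurd (hSM h) (notMem_M2B_of_mem_M1B hG hB hv)
    · exact ⟨s, hST hs, hvs⟩
  refine ⟨T, hT, isMaxIndep_iff.2 ⟨?_, fun v hv => ?_⟩, isMaxIndep_iff.2 ⟨?_, fun v hv => ?_⟩⟩
  · rw [Set.union_singleton]
    exact hT.insert_of_not_adj fun t ht h => (hTW ht).2.2.1 h.symm
  · obtain ⟨hvT, hvx⟩ := not_or.1 hv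
    by_cases hadj : G.Adj v x
    · exact ⟨x, .inr rfl, hadj⟩
    have : ∃ t ∈ T, G.Adj v t := by
      by_cases hvy : ∃ y ∈ Y, G.Adj v y
      · exact key v (.inr ((mem_M1Y_iff hB).2 ⟨hvx, hadj, hvy⟩))
      · push Not at hvy
        exact hTdom v ⟨hvx, fun h => hadj (hxY v h).symm, hadj, hvy⟩ hvT
    exact this.imp fun t ht => ⟨.inl ht.1, ht.2⟩
  · rintro a (ha | ha) b (hb | hb) hab h
    exacts [hT ha hb hab h, (hTW ha).2.2.2 b hb h, (hTW hb).2.2.2 a ha h.symm, hY a ha b hb h]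
  · obtain ⟨hvT, hvY⟩ := not_or.1 hv
    by_cases hadj : ∃ y ∈ Y, G.Adj v y
    · obtain ⟨y, hy, hvy⟩ := hadj
      exact ⟨y, .inr hy, hvy⟩
    push Not at hadj
    have : ∃ t ∈ T, G.Adj v t := by
      by_cases hvx : G.Adj v x
      · exact key v (.inl ((mem_M1X_iff hB).2 ⟨hvx, hvY, hadj⟩))
      · exact hTdom v ⟨fun h => hadj y₀ hy₀ (h ▸ hxY y₀ hy₀), hvY, hvx, hadj⟩ hvT
    exact this.imp fun t ht => ⟨.inl ht.1, ht.2⟩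

/-- If a star is generating, every vertex of `M₁(B)` has a neighbour in `M₂(B)`. -/
theorem IsGenerating.exists_adj_mem_M2B (h : IsGenerating G {x} Y) (hB : IsInducedStar G x Y)
    {v : V} (hv : v ∈ M1B G x Y) : ∃ t ∈ M2B G x Y, G.Adj v t := by
  obtain ⟨T, -, hX, hTY⟩ := h
  rw [isMaxIndep_iff] at hX hTY
  obtain ⟨⟨y₀, hy₀⟩, hxnY, hxY, hY⟩ := id hB
  have hnx : ∀ t ∈ T, ¬ G.Adj t x := fun t ht h => hX.1 (.inl ht) (.inr rfl) h.ne h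
  have hnY : ∀ t ∈ T, ∀ y ∈ Y, ¬ G.Adj t y :=
    fun t ht y hy h => hTY.1 (.inl ht) (.inr hy) h.ne h
  have hmem : ∀ t ∈ T, G.Adj v t → t ∈ M2B G x Y := fun t ht hvt =>
    mem_M2B_of_adj hB (fun h => hnY t ht y₀ hy₀ (h ▸ hxY y₀ hy₀))
      (fun h => hnx t ht (hxY t h).symm) (hnx t ht) (hnY t ht) hv hvt.symm
  rcases hv with hv | hv
  · obtain ⟨hvx, hvY, hvn⟩ := (mem_M1X_iff hB).1 hv
    obtain ⟨t, ht | ht, hvt⟩ := hTY.2 v (not_or.2 ⟨fun h => hnx v h hvx, hvY⟩)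
    exacts [⟨t, hmem t ht hvt, hvt⟩, absurd hvt (hvn t ht)]
  · obtain ⟨hvx, hvn, y, hy, hvy⟩ := (mem_M1Y_iff hB).1 hv
    obtain ⟨t, ht | rfl, hvt⟩ := hX.2 v (not_or.2 ⟨fun h => hnY v h y hy hvy, hvx⟩)
    exacts [⟨t, hmem t ht hvt, hvt⟩, absurd hvt hvn]

end Star

theorem isCompOf_setOf_reachable {V : Type*} (G : SimpleGraph V) {W : Set V} {v : V}
    (hv : v ∈ W) : IsCompOf G W {u | u ∈ W ∧ (restrict G W).Reachable u v} :=
  ⟨fun _ hu => hu.1, v, ⟨hv, .rfl⟩, rfl⟩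

/-- Let `S` contain exactly one vertex `w_C` from each connected component `C` of the
subgraph of `G` induced by `M₂(B)`, chosen so that `f(w_C) = f(V(C))`. Then `B` is
generating iff `S` dominates `M₁(B)`. -/
theorem stmt13 {V : Type*} (G : SimpleGraph V) (hG : IsChordal G)
    (x : V) (Y : Set V) (hB : IsInducedStar G x Y)
    (S : Set V) (hS1 : S ⊆ M2B G x Y)
    (hS2 : ∀ C, IsCompOf G (M2B G x Y) C →
      ∃ w, w ∈ S ∧ w ∈ C ∧ (∀ w' ∈ S, w' ∈ C → w' = w) ∧
        fSet G x Y {w} = fSet G x Y C) :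
    IsGenerating G {x} Y ↔ M1B G x Y ⊆ S ∪ nOne G S := by
  constructor
  · intro hgen v hv
    obtain ⟨t, ht, hvt⟩ := hgen.exists_adj_mem_M2B hB hv
    have hC := isCompOf_setOf_reachable G ht
    obtain ⟨w, hwS, -, -, hf⟩ := hS2 _ hC
    have hvM := notMem_M2B_of_mem_M1B hG hB hv
    have hvC : v ∈ fSet G x Y {u | u ∈ M2B G x Y ∧ (restrict G (M2B G x Y)).Reachable u t} :=
      ⟨⟨fun h => hvM h.1, t, ⟨ht, .rfl⟩, hvt⟩, hv⟩
    rw [← hf] at hvC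
    obtain ⟨⟨-, s, rfl, hvs⟩, -⟩ := hvC
    exact .inr ⟨fun h => hvM (hS1 h), s, hwS, hvs⟩
  · refine isGenerating_of_dominates hG hB (fun a ha b hb hab h => hab ?_) hS1
    obtain ⟨w, -, -, huniq, -⟩ := hS2 _ (isCompOf_setOf_reachable G (hS1 ha))
    have hba : (restrict G (M2B G x Y)).Adj b a := ⟨h.symm, hS1 hb, hS1 ha⟩
    exact (huniq a ha ⟨hS1 ha, .rfl⟩).trans (huniq b hb ⟨hS1 hb, hba.reachable⟩).symm
end

section
/- Let G be a finite simple chordal graph, let B be an induced complete bipartite subgraph of G with parts B_X = {x} and B_Y = {y_1,...,y_k}, and suppose there exists an independent set S ⊆ M_2(B) with M_1(B) ⊆ N_1(S). Then every maximal independent set S* of the subgraph of G induced by V(G) \ N_1[B] that contains S is a witness that B is generating: both S* ∪ B_X and S* ∪ B_Y are maximal independent sets of G. -/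
open SimpleGraph

/-- Let `I` be independent, with no vertex in `A ∪ C` or adjacent to `A ∪ C`, and maximal among
such sets. If `A` is independent, every vertex of `C` is adjacent to a vertex of `A`, and every
outside vertex that is adjacent to `C` but not to `A` is adjacent to `I`, then `I ∪ A` is a
maximal independent set. -/
theorem isMaxIndep_union_of_dominated {V : Type*} {G : SimpleGraph V} {A C I : Set V}
    (hA : _root_.IsIndepSet G A) (hC : ∀ c ∈ C, ∃ a ∈ A, G.Adj c a)
    (hdom : ∀ v, v ∉ A → v ∉ C → (∀ a ∈ A, ¬ G.Adj v a) → (∃ c ∈ C, G.Adj v c) →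
      ∃ s ∈ I, G.Adj v s)
    (hsub : I ⊆ ((A ∪ C) ∪ nOne G (A ∪ C))ᶜ) (hind : _root_.IsIndepSet G I)
    (hmax : ∀ T ⊆ ((A ∪ C) ∪ nOne G (A ∪ C))ᶜ, _root_.IsIndepSet G T → I ⊆ T → I = T) :
    IsMaxIndep G (I ∪ A) := by
  have hIA : ∀ s ∈ I, ∀ a ∈ A, ¬ G.Adj s a := fun s hs a ha hadj =>
    hsub hs (Or.inr ⟨fun h => hsub hs (Or.inl h), a, Or.inl ha, hadj⟩)
  refine ⟨?_, fun T hT hle => hle.antisymm fun v hv => ?_⟩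
  · rintro a (ha | ha) b (hb | hb) hab
    · exact hind ha hb hab
    · exact hIA a ha b hb
    · exact fun h => hIA b hb a ha h.symm
    · exact hA ha hb hab
  · by_contra hvn
    have hnadj : ∀ w ∈ I ∪ A, ¬ G.Adj v w := fun w hw hadj => hT hv (hle hw) hadj.ne hadj
    have hvI : v ∉ I := fun h => hvn (Or.inl h)
    have hvA : v ∉ A := fun h => hvn (Or.inr h)
    have hnA : ∀ a ∈ A, ¬ G.Adj v a := fun a ha => hnadj a (Or.inr ha)
    have hvC : v ∉ C := fun h => by
      obtain ⟨a, ha, hadj⟩ := hC v h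
      exact hnA a ha hadj
    have hnC : ∀ c ∈ C, ¬ G.Adj v c := fun c hc hadj => by
      obtain ⟨s, hs, h⟩ := hdom v hvA hvC hnA ⟨c, hc, hadj⟩
      exact hnadj s (Or.inl hs) h
    have hvout : v ∈ ((A ∪ C) ∪ nOne G (A ∪ C))ᶜ := by
      rintro ((h | h) | ⟨-, w, hw | hw, hadj⟩)
      · exact hvA h
      · exact hvC h
      · exact hnA w hw hadj
      · exact hnC w hw hadj
    have hins : I = insert v I := by
      refine hmax _ (Set.insert_subset hvout hsub) (hT.mono ?_) (Set.subset_insert v I)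
      exact Set.insert_subset hv (Set.subset_union_left.trans hle)
    exact hvI (hins ▸ Set.mem_insert v I)

/-- Suppose `S ⊆ M₂(B)` is independent with `M₁(B) ⊆ N₁(S)`. Then every maximal
independent set `S*` of the subgraph of `G` induced by `V(G) \ N₁[B]` that contains `S`
is a witness that `B` is generating: both `S* ∪ B_X` and `S* ∪ B_Y` are maximal
independent sets of `G`. -/
theorem stmt14 {V : Type*} (G : SimpleGraph V) (hG : IsChordal G)
    (x : V) (Y : Set V) (hB : IsInducedStar G x Y)
    (S : Set V) (hSsub : S ⊆ M2B G x Y) (hSind : _root_.IsIndepSet G S)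
    (hdom : M1B G x Y ⊆ nOne G S)
    (Sstar : Set V)
    (hsub : Sstar ⊆ (({x} ∪ Y) ∪ nOne G ({x} ∪ Y))ᶜ)
    (hind : _root_.IsIndepSet G Sstar)
    (hcont : S ⊆ Sstar)
    (hmax : ∀ T ⊆ (({x} ∪ Y) ∪ nOne G ({x} ∪ Y))ᶜ,
      _root_.IsIndepSet G T → Sstar ⊆ T → Sstar = T) :
    IsMaxIndep G (Sstar ∪ {x}) ∧ IsMaxIndep G (Sstar ∪ Y) := by
  obtain ⟨⟨y, hy⟩, -, hxY, hYY⟩ := hB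
  constructor
  · refine isMaxIndep_union_of_dominated (Set.pairwise_singleton _ _)
      (fun c hc => ⟨x, rfl, (hxY c hc).symm⟩) ?_ hsub hind hmax
    rintro v hvx hvY hnx ⟨c, hc, hadj⟩
    obtain ⟨-, s, hs, h⟩ := hdom
      (Or.inr ⟨⟨hvY, c, hc, hadj⟩, hvx, hnx, c, hadj, x, rfl, (hxY c hc).symm⟩)
    exact ⟨s, hcont hs, h⟩
  · rw [Set.union_comm {x} Y] at hsub hmax
    refine isMaxIndep_union_of_dominated (fun a ha b hb _ => hYY a ha b hb) ?_ ?_ hsub hind hmax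
    · rintro c rfl
      exact ⟨y, hy, hxY y hy⟩
    · rintro v hvY hvx hnY ⟨c, rfl, hadj⟩
      obtain ⟨-, s, hs, h⟩ := hdom
        (Or.inl ⟨⟨hvx, c, rfl, hadj⟩, hvY, hnY, c, hadj, y, hy, hxY y hy⟩)
      exact ⟨s, hcont hs, h⟩
end

section
/- Let G be a finite simple graph and let B be a generating subgraph of G with vertex sets of bipartition B_X and B_Y. Then every weight function w : V(G) → ℝ such that G is w-well-covered satisfies w(B_X) = w(B_Y). -/
open SimpleGraph

/-- A maximal independent set of `G`, as a finset. -/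
def IsMaxIndepF {V : Type*} (G : SimpleGraph V) (A : Finset V) : Prop :=
  _root_.IsIndepSet G ↑A ∧ ∀ B : Finset V, _root_.IsIndepSet G ↑B → A ⊆ B → A = B

/-- `G` is `w`-well-covered: all maximal independent sets of `G` have the same weight. -/
def IsWWellCovered {V : Type*} (G : SimpleGraph V) (w : V → ℝ) : Prop :=
  ∀ A B : Finset V, IsMaxIndepF G A → IsMaxIndepF G B → ∑ v ∈ A, w v = ∑ v ∈ B, w v

/-- If every vertex of `A` is adjacent to every vertex of the nonempty set `B`, then any `S` for
which `S ∪ B` is independent is disjoint from `A`. -/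
theorem disjoint_of_isIndepSet_union {V : Type*} [DecidableEq V] {G : SimpleGraph V}
    {S A B : Finset V} (hB : B.Nonempty) (hadj : ∀ a ∈ A, ∀ b ∈ B, G.Adj a b)
    (hind : _root_.IsIndepSet G ↑(S ∪ B)) : Disjoint S A := by
  obtain ⟨b, hb⟩ := hB
  refine Finset.disjoint_left.2 fun a haS haA => ?_
  have hab := hadj a haA b hb
  exact hind (by simp [haS]) (by simp [hb]) hab.ne hab

/-- A maximal independent finset of `G`, together with one of the parts of a
generating subgraph. Every weight function `w` such that `G` is `w`-well-covered
satisfies `w(B_X) = w(B_Y)`. -/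
theorem stmt15 {V : Type*} [Fintype V] [DecidableEq V] (G : SimpleGraph V)
    (BX BY : Finset V) (hBX : BX.Nonempty) (hBY : BY.Nonempty)
    (hdisj : Disjoint BX BY)
    (hXind : _root_.IsIndepSet G ↑BX) (hYind : _root_.IsIndepSet G ↑BY)
    (hbip : ∀ a ∈ BX, ∀ b ∈ BY, G.Adj a b)
    (hgen : ∃ S : Finset V, _root_.IsIndepSet G ↑S ∧
      IsMaxIndepF G (S ∪ BX) ∧ IsMaxIndepF G (S ∪ BY))
    (w : V → ℝ) (hw : IsWWellCovered G w) :
    ∑ v ∈ BX, w v = ∑ v ∈ BY, w v := by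
  obtain ⟨S, -, hX, hY⟩ := hgen
  have hSX : Disjoint S BX := disjoint_of_isIndepSet_union hBY hbip hY.1
  have hSY : Disjoint S BY :=
    disjoint_of_isIndepSet_union hBX (fun b hb a ha => (hbip a ha b hb).symm) hX.1
  have h := hw _ _ hX hY
  rw [Finset.sum_union hSX, Finset.sum_union hSY] at h
  exact add_left_cancel h
end

section
/- Let G be a finite simple graph. For every simplicial clique C of G, the characteristic function f_C belongs to WCW(G), i.e., G is f_C-well-covered. Moreover, the family {f_C : C a simplicial clique of G} is linearly independent, and hence dim WCW(G) ≥ sc(G), the number of simplicial cliques of G. -/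
open SimpleGraph

/-- A vertex is simplicial if its closed neighborhood is a clique. -/
def IsSimplicialVertex {V : Type*} (G : SimpleGraph V) (v : V) : Prop :=
  G.IsClique (insert v (G.neighborSet v))

/-- A simplicial clique is a maximal clique containing a simplicial vertex. -/
def IsSimplicialClique {V : Type*} (G : SimpleGraph V) (C : Set V) : Prop :=
  G.IsClique C ∧ (∀ D, G.IsClique D → C ⊆ D → C = D) ∧ ∃ v ∈ C, IsSimplicialVertex G v

/-- A simplicial clique is the closed neighborhood of each simplicial vertex in it. -/
theorem IsSimplicialClique.eq_insert_neighborSet {V : Type*} {G : SimpleGraph V} {C : Set V}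
    (hC : IsSimplicialClique G C) {v : V} (hv : v ∈ C) (hs : IsSimplicialVertex G v) :
    C = insert v (G.neighborSet v) := by
  refine hC.2.1 _ hs fun x hx => ?_
  by_cases h : x = v
  · exact Or.inl h
  · exact Or.inr (hC.1 hv hx (Ne.symm h))

/-- A maximal independent set contains every vertex to which it has no neighbor. -/
theorem IsMaxIndepF.mem_of_forall_not_adj {V : Type*} {G : SimpleGraph V} {A : Finset V}
    (hA : IsMaxIndepF G A) {v : V} (hv : ∀ a ∈ A, ¬ G.Adj v a) : v ∈ A := by
  classical
  have hins : _root_.IsIndepSet G ↑(insert v A) := by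
    rw [Finset.coe_insert]
    exact hA.1.insert fun b hb _ => ⟨hv b hb, fun h => hv b hb h.symm⟩
  rw [hA.2 _ hins (Finset.subset_insert v A)]
  exact Finset.mem_insert_self v A

/-- A maximal independent set meets a simplicial clique in exactly one vertex. -/
theorem IsMaxIndepF.sum_indicator_eq_one {V : Type*} {G : SimpleGraph V} {A : Finset V}
    {C : Set V} (hA : IsMaxIndepF G A) (hC : IsSimplicialClique G C) :
    ∑ v ∈ A, C.indicator (fun _ => (1 : ℝ)) v = 1 := by
  obtain ⟨v, hvC, hv⟩ := hC.2.2
  have hCv := hC.eq_insert_neighborSet hvC hv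
  obtain ⟨a, haA, haC⟩ : ∃ a ∈ A, a ∈ C := by
    by_contra! h
    exact h v (hA.mem_of_forall_not_adj fun a ha hadj =>
      h a ha (hCv ▸ Set.mem_insert_of_mem v hadj)) hvC
  rw [Finset.sum_eq_single_of_mem a haA fun b hb hba =>
    Set.indicator_of_notMem (fun hbC => hA.1 hb haA hba (hC.1 hbC haC hba)) _]
  exact Set.indicator_of_mem haC _

/-- The characteristic functions of the simplicial cliques are linearly independent. -/
theorem linearIndependent_indicator_simplicialClique {V : Type*} (G : SimpleGraph V) :
    LinearIndependent ℝ
      (fun C : {C : Set V // IsSimplicialClique G C} =>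
        (C : Set V).indicator fun _ => (1 : ℝ)) := by
  rw [linearIndependent_iff']
  intro s g hg C hCs
  obtain ⟨v, hvC, hv⟩ := C.2.2.2
  have hsum := congrFun hg v
  simp only [Finset.sum_apply, Pi.smul_apply, Pi.zero_apply] at hsum
  rw [Finset.sum_eq_single_of_mem C hCs fun D _ hDC => ?_] at hsum
  · simpa [Set.indicator_of_mem hvC] using hsum
  · have hvD : v ∉ (D : Set V) := fun hvD => hDC <| Subtype.ext <|
      (D.2.eq_insert_neighborSet hvD hv).trans (C.2.eq_insert_neighborSet hvC hv).symm
    simp [Set.indicator_of_notMem hvD]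

/-- For every simplicial clique `C` of `G`, the characteristic function `f_C` belongs
to `WCW(G)`; the family `{f_C}` is linearly independent; hence for any submodule `W`
realizing `WCW(G)` we have `sc(G) ≤ dim W`. -/
theorem stmt17 {V : Type*} [Fintype V] (G : SimpleGraph V) :
    (∀ C : Set V, IsSimplicialClique G C →
      IsWWellCovered G (C.indicator fun _ => (1 : ℝ))) ∧
    LinearIndependent ℝ
      (fun C : {C : Set V // IsSimplicialClique G C} =>
        (C : Set V).indicator fun _ => (1 : ℝ)) ∧
    ∀ W : Submodule ℝ (V → ℝ), (W : Set (V → ℝ)) = {w | IsWWellCovered G w} →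
      Nat.card {C : Set V // IsSimplicialClique G C} ≤ Module.finrank ℝ W := by
  have hmem : ∀ C : Set V, IsSimplicialClique G C →
      IsWWellCovered G (C.indicator fun _ => (1 : ℝ)) := fun C hC A B hA hB =>
    (hA.sum_indicator_eq_one hC).trans (hB.sum_indicator_eq_one hC).symm
  refine ⟨hmem, linearIndependent_indicator_simplicialClique G, fun W hW => ?_⟩
  have hW' : ∀ C : {C : Set V // IsSimplicialClique G C},
      ((C : Set V).indicator fun _ => (1 : ℝ)) ∈ W := fun C => by
    rw [← SetLike.mem_coe, hW]
    exact hmem C C.2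
  have hli : LinearIndependent ℝ
      (fun C : {C : Set V // IsSimplicialClique G C} =>
        (⟨(C : Set V).indicator fun _ => (1 : ℝ), hW' C⟩ : W)) :=
    LinearIndependent.of_comp W.subtype (linearIndependent_indicator_simplicialClique G)
  have := Fintype.ofFinite {C : Set V // IsSimplicialClique G C}
  rw [Nat.card_eq_fintype_card]
  exact hli.fintype_card_le_finrank
end

section
/- Let G be a finite simple chordal graph. Then G is well-covered if and only if every vertex of G belongs to exactly one simplicial clique. -/
open SimpleGraph

/-- In a chordal graph, two neighbors of `x` joined by a path whose other vertices are not
neighbors of `x` are equal or adjacent. -/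
theorem IsChordal.eq_or_adj_of_reachable {V : Type*} {G H : SimpleGraph V} (hG : IsChordal G)
    {W : Set V} (hH : ∀ u v, H.Adj u v ↔ G.Adj u v ∧ u ∈ W ∧ v ∈ W) {x a b : V}
    (hx : x ∉ W) (ha : a ∈ W) (hxa : G.Adj x a) (hxb : G.Adj x b)
    (hW : ∀ w ∈ W, G.Adj x w → w = a ∨ w = b) (hab : H.Reachable a b) :
    a = b ∨ G.Adj a b := by
  classical
  obtain ⟨p, hp⟩ := hab.exists_walk_length_eq_dist
  by_contra! hcon
  have hd : ∀ i ≤ p.length, H.dist a (p.getVert i) = i := by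
    intro i hi
    have h1 := dist_le (p.take i)
    have h2 := dist_le (p.drop i)
    have h3 := (p.take i).reachable.dist_triangle_left b
    rw [Walk.take_length] at h1
    rw [Walk.drop_length] at h2
    omega
  have hmem : ∀ i ≤ p.length, p.getVert i ∈ W := by
    intro i hi
    rcases Nat.eq_zero_or_pos i with rfl | h0
    · simpa using ha
    · have := p.adj_getVert_succ (i := i - 1) (by omega)
      rw [Nat.sub_add_cancel h0] at this
      exact ((hH _ _).1 this).2.2
  have hadj : ∀ i ≤ p.length, ∀ j ≤ p.length,
      (G.Adj (p.getVert i) (p.getVert j) ↔ i + 1 = j ∨ j + 1 = i) := by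
    intro i hi j hj
    constructor
    · intro h
      have h' : H.Adj (p.getVert i) (p.getVert j) := (hH _ _).2 ⟨h, hmem i hi, hmem j hj⟩
      have hne : i ≠ j := by rintro rfl; exact h.ne rfl
      have h1 := h'.diff_dist_adj (u := a)
      rw [hd i hi, hd j hj] at h1
      omega
    · rintro (rfl | rfl)
      · exact ((hH _ _).1 (p.adj_getVert_succ (by omega))).1
      · exact ((hH _ _).1 (p.adj_getVert_succ (by omega))).1.symm
  have hlen : 2 ≤ p.length := by
    by_contra hlt
    have h : p.length = 0 ∨ p.length = 1 := by omega
    rcases h with h | h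
    · exact hcon.1 (Walk.eq_of_length_eq_zero h)
    · exact hcon.2 ((hH _ _).1 (Walk.adj_of_length_eq_one h)).1
  have hxadj : ∀ i ≤ p.length, (G.Adj x (p.getVert i) ↔ i = 0 ∨ i = p.length) := by
    intro i hi
    constructor
    · intro h
      have h1 := hd i hi
      rcases hW _ (hmem i hi) h with h2 | h2
      · rw [h2, dist_self] at h1; exact .inl h1.symm
      · rw [h2, ← hp] at h1; exact .inr h1.symm
    · rintro (rfl | rfl)
      · simpa using hxa
      · simpa using hxb
  let c : Fin (p.length + 2) → V := fun i => if i.1 ≤ p.length then p.getVert i.1 else x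
  have hinj : Function.Injective c := by
    intro i j hij
    have hi := i.2
    have hj := j.2
    simp only [c] at hij
    apply Fin.ext
    split_ifs at hij with h1 h2 h2
    · rw [← hd _ h1, ← hd _ h2, hij]
    · exact (hx (hij ▸ hmem _ h1)).elim
    · exact (hx (hij ▸ hmem _ h2)).elim
    · omega
  have hcadj : ∀ i j, G.Adj (c i) (c j) ↔ (cycleGraph (p.length + 2)).Adj i j := by
    intro i j
    have hi := i.2
    have hj := j.2
    have hsub : ∀ i j : Fin (p.length + 2), (i - j).val = 1 ↔
        i.1 = j.1 + 1 ∨ (i.1 = 0 ∧ j.1 = p.length + 1) := by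
      intro i j
      have hi := i.2
      have hj := j.2
      rcases le_or_gt j i with h | h
      · rw [Fin.sub_val_of_le h]
        rw [Fin.le_def] at h
        omega
      · rw [Fin.coe_sub_iff_lt.2 h]
        rw [Fin.lt_def] at h
        omega
    rw [cycleGraph_adj', hsub, hsub]
    simp only [c]
    split_ifs with h1 h2 h2
    · rw [hadj _ h1 _ h2]; omega
    · rw [G.adj_comm, hxadj _ h1]; omega
    · rw [hxadj _ h2]; omega
    · simp only [SimpleGraph.irrefl, false_iff]; omega
  refine (hG (p.length + 2) (by omega) (Set.range c)).false ?_
  exact (RelIso.mk (Equiv.ofInjective c hinj) (by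
    intro i j
    exact hcadj i j) : cycleGraph (p.length + 2) ≃g G.induce (Set.range c)).symm

/-- The vertex `y` is simplicial in the subgraph induced on `S`. -/
def IsSimplicialIn {V : Type*} (G : SimpleGraph V) (S : Finset V) (y : V) : Prop :=
  y ∈ S ∧ ∀ u ∈ S, ∀ v ∈ S, G.Adj y u → G.Adj y v → u ≠ v → G.Adj u v

/-- Dirac's lemma, relative to a vertex `x` that is not universal in `S`. -/
theorem IsChordal.exists_isSimplicialIn_not_adj {V : Type*} {G : SimpleGraph V}
    (hG : IsChordal G) (S : Finset V) : ∀ x ∈ S, (∃ z ∈ S, z ≠ x ∧ ¬ G.Adj x z) →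
      ∃ y, IsSimplicialIn G S y ∧ y ≠ x ∧ ¬ G.Adj x y := by
  classical
  induction S using Finset.strongInduction with
  | H S ih =>
  rintro x hxS ⟨z, hzS, hzx, hxz⟩
  let far : V → Prop := fun v => v ∈ S ∧ v ≠ x ∧ ¬ G.Adj x v
  let K : SimpleGraph V :=
    { Adj := fun u v => G.Adj u v ∧ far u ∧ far v
      symm := ⟨fun u v h => ⟨h.1.symm, h.2.2, h.2.1⟩⟩
      loopless := ⟨fun u h => h.1.ne rfl⟩ }
  let D : Finset V := S.filter fun v => far v ∧ K.Reachable z v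
  let T : Finset V := S.filter fun t => t ∉ D ∧ ∃ d ∈ D, G.Adj t d
  have hD : ∀ v, v ∈ D ↔ far v ∧ K.Reachable z v := by
    intro v
    simp only [D, Finset.mem_filter]
    exact ⟨fun h => h.2, fun h => ⟨h.1.1, h⟩⟩
  have hT : ∀ t, t ∈ T ↔ t ∈ S ∧ t ∉ D ∧ ∃ d ∈ D, G.Adj t d := by
    intro t
    simp only [T, Finset.mem_filter]
  have hzD : z ∈ D := (hD z).2 ⟨⟨hzS, hzx, hxz⟩, Reachable.refl _⟩
  have hTx : ∀ t ∈ T, G.Adj x t := by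
    intro t ht
    obtain ⟨htS, htD, d, hd, htd⟩ := (hT t).1 ht
    obtain ⟨hdf, hdr⟩ := (hD d).1 hd
    by_contra hxt
    have htf : far t := ⟨htS, by rintro rfl; exact hdf.2.2 htd, hxt⟩
    have hK : K.Adj d t := ⟨htd.symm, hdf, htf⟩
    exact htD ((hD t).2 ⟨htf, hdr.trans hK.reachable⟩)
  have hTc : ∀ a ∈ T, ∀ b ∈ T, a ≠ b → G.Adj a b := by
    intro a ha b hb hab
    obtain ⟨-, -, d, hd, had⟩ := (hT a).1 ha
    obtain ⟨-, -, e, he, hbe⟩ := (hT b).1 hb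
    obtain ⟨hdf, hdr⟩ := (hD d).1 hd
    obtain ⟨hef, her⟩ := (hD e).1 he
    let W : Set V := {v | far v ∨ v = a ∨ v = b}
    let H : SimpleGraph V :=
      { Adj := fun u v => G.Adj u v ∧ u ∈ W ∧ v ∈ W
        symm := ⟨fun u v h => ⟨h.1.symm, h.2.2, h.2.1⟩⟩
        loopless := ⟨fun u h => h.1.ne rfl⟩ }
    have hKH : K ≤ H := fun u v h => ⟨h.1, .inl h.2.1, .inl h.2.2⟩
    have h1 : H.Adj a d := ⟨had, .inr (.inl rfl), .inl hdf⟩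
    have h2 : H.Adj e b := ⟨hbe.symm, .inl hef, .inr (.inr rfl)⟩
    refine (hG.eq_or_adj_of_reachable (H := H) (W := W) (fun _ _ => Iff.rfl) (x := x) ?_
      (.inr (.inl rfl)) (hTx a ha) (hTx b hb) ?_ ?_).resolve_left hab
    · rintro (h | h | h)
      · exact h.2.1 rfl
      · exact (hTx a ha).ne h
      · exact (hTx b hb).ne h
    · rintro w (h | h) hw
      · exact (h.2.2 hw).elim
      · exact h
    · exact h1.reachable.trans (((hdr.symm.trans her).mono hKH).trans h2.reachable)
  have hDT : ∀ u, u ∈ D ∪ T ↔ u ∈ D ∨ u ∈ T := fun u => Finset.mem_union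
  have hlift : ∀ y ∈ D, IsSimplicialIn G (D ∪ T) y →
      ∃ y, IsSimplicialIn G S y ∧ y ≠ x ∧ ¬ G.Adj x y := by
    intro y hy hs
    have hyf := ((hD y).1 hy).1
    have hnb : ∀ u ∈ S, G.Adj y u → u ∈ D ∪ T := by
      intro u hu hyu
      rw [hDT, hT]
      by_cases h : u ∈ D
      · exact .inl h
      · exact .inr ⟨hu, h, y, hy, hyu.symm⟩
    exact ⟨y, ⟨hyf.1, fun u hu v hv hyu hyv =>
      hs.2 u (hnb u hu hyu) v (hnb v hv hyv) hyu hyv⟩, hyf.2⟩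
  have hss : D ∪ T ⊂ S := by
    refine (Finset.ssubset_iff_of_subset ?_).2 ⟨x, hxS, ?_⟩
    · exact Finset.union_subset (Finset.filter_subset _ _) (Finset.filter_subset _ _)
    · rw [hDT]
      rintro (h | h)
      · exact ((hD x).1 h).1.2.1 rfl
      · exact (hTx x h).ne rfl
  by_cases h1 : ∃ t ∈ T, ∃ u ∈ D ∪ T, u ≠ t ∧ ¬ G.Adj t u
  · obtain ⟨t, ht, hu⟩ := h1
    obtain ⟨y, hs, hyt, hty⟩ := ih _ hss t ((hDT t).2 (.inr ht)) hu
    refine hlift y (((hDT y).1 hs.1).resolve_right fun h => ?_) hs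
    exact hty (hTc t ht y h hyt.symm)
  push Not at h1
  by_cases h2 : ∃ d ∈ D, ∃ u ∈ D ∪ T, u ≠ d ∧ ¬ G.Adj d u
  · obtain ⟨d, hd, hu⟩ := h2
    obtain ⟨y, hs, hyd, hdy⟩ := ih _ hss d ((hDT d).2 (.inl hd)) hu
    refine hlift y (((hDT y).1 hs.1).resolve_right fun h => ?_) hs
    exact hdy (h1 y h d ((hDT d).2 (.inl hd)) hyd.symm).symm
  push Not at h2
  refine hlift z hzD ⟨(hDT z).2 (.inl hzD), fun u hu v hv _ _ huv => ?_⟩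
  rcases (hDT u).1 hu with h | h
  · exact h2 u h v hv huv.symm
  · exact h1 u h v hv huv.symm

/-- Dirac's theorem: every nonempty induced subgraph of a chordal graph has a simplicial
vertex. -/
theorem IsChordal.exists_isSimplicialIn {V : Type*} {G : SimpleGraph V}
    (hG : IsChordal G) {S : Finset V} (hS : S.Nonempty) : ∃ y, IsSimplicialIn G S y := by
  by_cases h : ∃ x ∈ S, ∃ z ∈ S, z ≠ x ∧ ¬ G.Adj x z
  · obtain ⟨x, hx, hz⟩ := h
    obtain ⟨y, hy, -⟩ := hG.exists_isSimplicialIn_not_adj S x hx hz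
    exact ⟨y, hy⟩
  · push Not at h
    obtain ⟨y, hy⟩ := hS
    exact ⟨y, hy, fun u hu v hv _ _ huv => h u hu v hv huv.symm⟩

/-- A set of vertices of a chordal graph can be covered by as many cliques as some independent
subset has elements; the cliques are the fibers of `f`. -/
theorem IsChordal.exists_clique_cover {V : Type*} {G : SimpleGraph V} (hG : IsChordal G)
    (S : Finset V) : ∃ A ⊆ S, ∃ f : V → V, _root_.IsIndepSet G (A : Set V) ∧
      (∀ v ∈ S, f v ∈ A) ∧ ∀ v ∈ S, ∀ w ∈ S, f v = f w → v ≠ w → G.Adj v w := by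
  classical
  induction S using Finset.strongInduction with
  | H S ih =>
  rcases S.eq_empty_or_nonempty with rfl | hS
  · exact ⟨∅, subset_rfl, id, by simp [_root_.IsIndepSet], by simp, by simp⟩
  obtain ⟨y, hyS, hy⟩ := hG.exists_isSimplicialIn hS
  let R : Finset V := S.filter fun v => v ≠ y ∧ ¬ G.Adj y v
  have hR : ∀ v, v ∈ R ↔ v ∈ S ∧ v ≠ y ∧ ¬ G.Adj y v := fun v => by
    simp only [R, Finset.mem_filter]
  have hRS : R ⊂ S := (Finset.ssubset_iff_of_subset (Finset.filter_subset _ _)).2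
    ⟨y, hyS, fun h => ((hR y).1 h).2.1 rfl⟩
  obtain ⟨A, hAR, f, hA, hfA, hf⟩ := ih R hRS
  have hyA : ∀ v ∈ R, f v ≠ y := fun v hv h =>
    ((hR y).1 (hAR (h ▸ hfA v hv))).2.1 rfl
  refine ⟨insert y A, ?_, fun v => if v ∈ R then f v else y, ?_, ?_, ?_⟩
  · exact Finset.insert_subset hyS (hAR.trans hRS.1)
  · rw [_root_.IsIndepSet, Finset.coe_insert]
    refine Set.Pairwise.insert hA fun a ha _ => ?_
    have := ((hR a).1 (hAR ha)).2.2
    exact ⟨this, fun h => this h.symm⟩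
  · intro v hv
    dsimp only
    split_ifs with h
    · exact Finset.mem_insert_of_mem (hfA v h)
    · exact Finset.mem_insert_self _ _
  · intro v hv w hw hvw hne
    have hnR : ∀ u ∈ S, u ∉ R → u = y ∨ G.Adj y u := by
      intro u hu h
      by_contra! h'
      exact h ((hR u).2 ⟨hu, h'⟩)
    dsimp only at hvw
    split_ifs at hvw with h1 h2 h2
    · exact hf v h1 w h2 hvw hne
    · exact (hyA v h1 hvw).elim
    · exact (hyA w h2 hvw.symm).elim
    · rcases hnR v hv h1 with rfl | h3
      · exact (hnR w hw h2).resolve_left hne.symm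
      · rcases hnR w hw h2 with rfl | h4
        · exact h3.symm
        · exact hy v hv w hw h3 h4 hne

/-- In a chordal graph, a clique all of whose vertices have a neighbor outside of it is dominated
by an independent set disjoint from it. -/
theorem IsChordal.exists_indep_dominating {V : Type*} [Fintype V] {G : SimpleGraph V}
    (hG : IsChordal G) {Q : Set V} (hQ : G.IsClique Q) (hout : ∀ q ∈ Q, ∃ u ∉ Q, G.Adj q u) :
    ∃ I : Finset V, _root_.IsIndepSet G (I : Set V) ∧ ∀ q ∈ Q, ∃ i ∈ I, G.Adj q i := by
  classical
  let dom : Finset V → Finset V := fun I =>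
    Finset.univ.filter fun q => q ∈ Q ∧ ∃ i ∈ I, G.Adj q i
  have hdom : ∀ I q, q ∈ dom I ↔ q ∈ Q ∧ ∃ i ∈ I, G.Adj q i := fun I q => by simp [dom]
  let F : Finset (Finset V) := Finset.univ.filter fun I =>
    _root_.IsIndepSet G (I : Set V) ∧ ∀ i ∈ I, i ∉ Q
  have hF : ∀ I, I ∈ F ↔ _root_.IsIndepSet G (I : Set V) ∧ ∀ i ∈ I, i ∉ Q := fun I => by simp [F]
  obtain ⟨I, hIF, hmax⟩ := F.exists_max_image (fun I => (dom I).card)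
    ⟨∅, (hF ∅).2 ⟨by simp [_root_.IsIndepSet], by simp⟩⟩
  obtain ⟨hI, hIQ⟩ := (hF I).1 hIF
  refine ⟨I, hI, fun q hq => ?_⟩
  by_contra! hqI
  obtain ⟨u, huQ, hqu⟩ := hout q hq
  let J : Finset V := insert u (I.filter fun i => ¬ G.Adj u i)
  have hJ : J ∈ F := by
    refine (hF J).2 ⟨?_, ?_⟩
    · rw [_root_.IsIndepSet, Finset.coe_insert]
      refine Set.Pairwise.insert (hI.mono (Finset.coe_subset.2 (Finset.filter_subset _ _))) fun i hi _ => ?_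
      have := (Finset.mem_filter.1 hi).2
      exact ⟨this, fun h => this h.symm⟩
    · intro i hi
      rcases Finset.mem_insert.1 hi with rfl | hi
      · exact huQ
      · exact hIQ i (Finset.mem_filter.1 hi).1
  have hlt : dom I ⊂ dom J := by
    refine (Finset.ssubset_iff_of_subset ?_).2 ⟨q, ?_, ?_⟩
    · intro p hp
      obtain ⟨hpQ, i, hi, hpi⟩ := (hdom I p).1 hp
      refine (hdom J p).2 ⟨hpQ, ?_⟩
      by_cases hui : G.Adj u i
      · refine ⟨u, Finset.mem_insert_self _ _, ?_⟩
        by_contra hpu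
        have hpq : p ≠ q := by rintro rfl; exact hqI i hi hpi
        let W : Set V := {v | v = i ∨ v = u ∨ v = q}
        let H : SimpleGraph V :=
          { Adj := fun u v => G.Adj u v ∧ u ∈ W ∧ v ∈ W
            symm := ⟨fun u v h => ⟨h.1.symm, h.2.2, h.2.1⟩⟩
            loopless := ⟨fun u h => h.1.ne rfl⟩ }
        have h1 : H.Adj i u := ⟨hui.symm, .inl rfl, .inr (.inl rfl)⟩
        have h2 : H.Adj u q := ⟨hqu.symm, .inr (.inl rfl), .inr (.inr rfl)⟩
        have := hG.eq_or_adj_of_reachable (H := H) (W := W) (fun _ _ => Iff.rfl) (x := p)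
          (a := i) (b := q) ?_ (.inl rfl) hpi (hQ hpQ hq hpq) ?_ (h1.reachable.trans h2.reachable)
        · rcases this with rfl | h
          · exact hIQ _ hi hq
          · exact hqI i hi h.symm
        · rintro (h | h | h)
          · exact hpi.ne h
          · exact huQ (h ▸ hpQ)
          · exact hpq h
        · rintro w (h | h | h) hw
          · exact .inl h
          · exact (hpu (h ▸ hw)).elim
          · exact .inr h
      · exact ⟨i, Finset.mem_insert_of_mem (Finset.mem_filter.2 ⟨hi, hui⟩), hpi⟩
    · exact (hdom J q).2 ⟨hq, u, Finset.mem_insert_self _ _, hqu⟩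
    · intro h
      obtain ⟨-, i, hi, hqi⟩ := (hdom I q).1 h
      exact hqI i hi hqi
  exact (Finset.card_lt_card hlt).not_ge (hmax J hJ)

theorem exists_isMaxIndepF_superset {V : Type*} [Fintype V] (G : SimpleGraph V) {I : Finset V}
    (hI : _root_.IsIndepSet G (I : Set V)) : ∃ B, IsMaxIndepF G B ∧ I ⊆ B := by
  obtain ⟨B, hIB, hB⟩ :=
    (Set.toFinite {B : Finset V | _root_.IsIndepSet G (B : Set V)}).exists_le_maximal hI
  exact ⟨B, ⟨hB.1, fun C hC hBC => le_antisymm hBC (hB.2 hC hBC)⟩, hIB⟩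

theorem IsMaxIndepF.mem_or_exists_adj {V : Type*} {G : SimpleGraph V} {A : Finset V}
    (hA : IsMaxIndepF G A) (v : V) : v ∈ A ∨ ∃ a ∈ A, G.Adj v a := by
  classical
  by_contra! h
  have hins : _root_.IsIndepSet G ((insert v A : Finset V) : Set V) := by
    rw [_root_.IsIndepSet, Finset.coe_insert]
    exact Set.Pairwise.insert hA.1 fun a ha _ => ⟨h.2 a ha, fun h' => h.2 a ha h'.symm⟩
  exact h.1 (hA.2 _ hins (Finset.subset_insert v A) ▸ Finset.mem_insert_self v A)

theorem IsSimplicialClique.exists_eq_insert_neighborSet {V : Type*} {G : SimpleGraph V}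
    {C : Set V} (hC : IsSimplicialClique G C) :
    ∃ q, IsSimplicialVertex G q ∧ C = insert q (G.neighborSet q) := by
  obtain ⟨hc, hmax, q, hq, hs⟩ := hC
  refine ⟨q, hs, hmax _ hs fun v hv => ?_⟩
  by_cases h : v = q
  · exact .inl h
  · exact .inr (hc hq hv (Ne.symm h))

theorem IsMaxIndepF.exists_mem_isSimplicialClique {V : Type*} {G : SimpleGraph V} {A : Finset V}
    (hA : IsMaxIndepF G A) {C : Set V} (hC : IsSimplicialClique G C) : ∃ a ∈ A, a ∈ C := by
  obtain ⟨q, -, rfl⟩ := hC.exists_eq_insert_neighborSet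
  rcases hA.mem_or_exists_adj q with h | ⟨a, ha, hqa⟩
  · exact ⟨q, h, .inl rfl⟩
  · exact ⟨a, ha, .inr hqa⟩

theorem card_le_card_of_existsUnique_isSimplicialClique {V : Type*} {G : SimpleGraph V}
    (h : ∀ v : V, ∃! C : Set V, IsSimplicialClique G C ∧ v ∈ C) {A B : Finset V}
    (hA : _root_.IsIndepSet G (A : Set V)) (hB : IsMaxIndepF G B) : A.card ≤ B.card := by
  choose C hC hu using h
  choose g hgB hgC using fun v => hB.exists_mem_isSimplicialClique (hC v).1
  refine Finset.card_le_card_of_injOn g (fun a _ => hgB a) fun a ha b hb hab => ?_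
  by_contra hne
  have h1 : C a = C (g a) := hu _ _ ⟨(hC a).1, hgC a⟩
  have h2 : C b = C (g a) := hu _ _ ⟨(hC b).1, hab ▸ hgC b⟩
  exact hA ha hb hne ((hC a).1.1 (hC a).2 (by rw [h1, ← h2]; exact (hC b).2) hne)

/-- In a well-covered graph, distinct simplicial cliques are disjoint. -/
theorem IsSimplicialClique.eq_of_mem {V : Type*} [Fintype V] {G : SimpleGraph V}
    (hw : ∀ A B : Finset V, IsMaxIndepF G A → IsMaxIndepF G B → A.card = B.card)
    {C D : Set V} (hC : IsSimplicialClique G C) (hD : IsSimplicialClique G D) {v : V}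
    (hvC : v ∈ C) (hvD : v ∈ D) : C = D := by
  classical
  obtain ⟨x, hx, hCx⟩ := hC.exists_eq_insert_neighborSet
  obtain ⟨y, hy, hDy⟩ := hD.exists_eq_insert_neighborSet
  by_contra hne
  have hxC : x ∈ C := by rw [hCx]; exact .inl rfl
  have hyD : y ∈ D := by rw [hDy]; exact .inl rfl
  have hxD : x ∉ D := by
    intro h
    refine hne (hD.2.1 C hC.1 ?_).symm
    intro w hw
    by_cases hwx : w = x
    · exact hwx ▸ hxC
    · rw [hCx]; exact .inr (hD.1 h hw (Ne.symm hwx))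
  have hxy : x ≠ y := by rintro rfl; exact hxD hyD
  have hnxy : ¬ G.Adj x y := fun h => hxD (by rw [hDy]; exact .inr h.symm)
  obtain ⟨A, hA, hvA⟩ := exists_isMaxIndepF_superset G (I := {v}) (by simp [_root_.IsIndepSet])
  rw [Finset.singleton_subset_iff] at hvA
  have key : ∀ E : Set V, G.IsClique E → v ∈ E → ∀ a ∈ A.erase v, a ∉ E := by
    intro E hE hvE a ha haE
    rw [Finset.mem_erase] at ha
    exact hA.1 ha.2 hvA ha.1 (hE haE hvE ha.1)
  have keyx : ∀ a ∈ A.erase v, a ≠ x ∧ ¬ G.Adj x a := by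
    intro a ha
    have := key C hC.1 hvC a ha
    rw [hCx] at this
    exact ⟨fun h => this (.inl h), fun h => this (.inr h)⟩
  have keyy : ∀ a ∈ A.erase v, a ≠ y ∧ ¬ G.Adj y a := by
    intro a ha
    have := key D hD.1 hvD a ha
    rw [hDy] at this
    exact ⟨fun h => this (.inl h), fun h => this (.inr h)⟩
  have hyA : y ∉ A.erase v := fun h => (keyy y h).1 rfl
  have hxA : x ∉ insert y (A.erase v) := by
    intro h
    rcases Finset.mem_insert.1 h with h | h
    · exact hxy h
    · exact (keyx x h).1 rfl
  have hI : _root_.IsIndepSet G ((insert x (insert y (A.erase v)) : Finset V) : Set V) := by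
    rw [_root_.IsIndepSet, Finset.coe_insert, Finset.coe_insert]
    refine Set.Pairwise.insert (Set.Pairwise.insert (hA.1.mono (by simp)) ?_) ?_
    · exact fun a ha _ => ⟨(keyy a ha).2, fun h => (keyy a ha).2 h.symm⟩
    · rintro a (rfl | ha) _
      · exact ⟨hnxy, fun h => hnxy h.symm⟩
      · exact ⟨(keyx a ha).2, fun h => (keyx a ha).2 h.symm⟩
  obtain ⟨B, hB, hIB⟩ := exists_isMaxIndepF_superset G hI
  have h1 := Finset.card_le_card hIB
  rw [Finset.card_insert_of_notMem hxA, Finset.card_insert_of_notMem hyA,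
    Finset.card_erase_of_mem hvA] at h1
  have h2 := hw A B hA hB
  have h3 := Finset.card_pos.2 ⟨v, hvA⟩
  omega

/-- Every vertex of a well-covered chordal graph lies in a simplicial clique. -/
theorem IsChordal.exists_isSimplicialClique {V : Type*} [Fintype V] {G : SimpleGraph V}
    (hG : IsChordal G)
    (hw : ∀ A B : Finset V, IsMaxIndepF G A → IsMaxIndepF G B → A.card = B.card) (v : V) :
    ∃ C, IsSimplicialClique G C ∧ v ∈ C := by
  classical
  obtain ⟨A, -, f, hA, hfA, hf⟩ := hG.exists_clique_cover Finset.univ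
  simp only [Finset.mem_univ, true_imp_iff] at hfA hf
  obtain ⟨A', hA', hAA'⟩ := exists_isMaxIndepF_superset G hA
  let Q : Set V := {w | f w = f v}
  have hQ : G.IsClique Q := fun a ha b hb hab =>
    hf a b (Eq.trans ha (Eq.symm hb)) hab
  have hmeet : ∀ B, IsMaxIndepF G B → ∃ b ∈ B, b ∈ Q := by
    intro B hB
    have hle : A.card ≤ B.card := (Finset.card_le_card hAA').trans (hw A' B hA' hB).le
    have hinj : Set.InjOn f B := by
      intro a ha b hb hab
      by_contra hne
      exact hB.1 ha hb hne (hf a b hab hne)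
    obtain ⟨b, hb, hbv⟩ :=
      Finset.surjOn_of_injOn_of_card_le f (fun b _ => hfA b) hinj hle (hfA v)
    exact ⟨b, hb, hbv⟩
  have hin : ∃ q ∈ Q, ∀ u, G.Adj q u → u ∈ Q := by
    by_contra! hout
    obtain ⟨I, hI, hd⟩ := hG.exists_indep_dominating hQ fun q hq =>
      (hout q hq).imp fun u h => ⟨h.2, h.1⟩
    obtain ⟨B, hB, hIB⟩ := exists_isMaxIndepF_superset G hI
    obtain ⟨b, hbB, hbQ⟩ := hmeet B hB
    obtain ⟨i, hi, hbi⟩ := hd b hbQ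
    exact hB.1 hbB (hIB hi) hbi.ne hbi
  obtain ⟨q, hq, hqn⟩ := hin
  refine ⟨Q, ⟨hQ, fun D hD hQD => hQD.antisymm fun w hw => ?_, q, hq, ?_⟩, rfl⟩
  · by_cases h : w = q
    · exact h ▸ hq
    · exact hqn w (hD (hQD hq) hw (Ne.symm h))
  · exact hQ.subset (Set.insert_subset hq fun u hu => hqn u hu)

/-- A chordal graph `G` is well-covered iff every vertex of `G` belongs to exactly one
simplicial clique. -/
theorem stmt18 {V : Type*} [Fintype V] (G : SimpleGraph V) (hG : IsChordal G) :
    (∀ A B : Finset V, IsMaxIndepF G A → IsMaxIndepF G B → A.card = B.card) ↔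
      ∀ v : V, ∃! C : Set V, IsSimplicialClique G C ∧ v ∈ C := by
  constructor
  · intro hw v
    obtain ⟨C, hC, hv⟩ := hG.exists_isSimplicialClique hw v
    exact ⟨C, ⟨hC, hv⟩, fun D hD => hD.1.eq_of_mem hw hC hD.2 hv⟩
  · intro h A B hA hB
    exact (card_le_card_of_existsUnique_isSimplicialClique h hA.1 hB).antisymm
      (card_le_card_of_existsUnique_isSimplicialClique h hB.1 hA)
end
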